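/- arXiv:0802.2157 — 3 statements merged into one kernel-verified Lean document; each statement's English description precedes it below -/
import Mathlib

section
/- If r ≥ 1 and m_i ≥ 2 for every i with 1 ≤ i ≤ r, then for every positive integer k the complete r-partite graph K_{m₁,…,m_r} satisfies ch_k(K_{m₁,…,m_r}) ≤ 948·r·(k + log((m₁ + ⋯ + m_r)/r)), where log denotes the natural logarithm. -/
/-- A graph `G` is `(a:b)`-choosable if for every assignment of color sets of size `a`
to the vertices, one can choose subsets of size `b` that are disjoint on adjacent vertices. -/
def SimpleGraph.Choosable {V : Type*} (G : SimpleGraph V) (a b : ℕ) : Prop :=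
  ∀ S : V → Finset ℕ, (∀ v, (S v).card = a) →
    ∃ C : V → Finset ℕ, (∀ v, C v ⊆ S v) ∧ (∀ v, (C v).card = b) ∧
      ∀ u v, G.Adj u v → Disjoint (C u) (C v)

/-- The `k`-th choice number of `G`: the least `n` such that `G` is `(n:k)`-choosable. -/
noncomputable def SimpleGraph.chooseNum {V : Type*} (G : SimpleGraph V) (k : ℕ) : ℕ :=
  sInf {n | G.Choosable n k}

/-- Greedy choice of pairwise disjoint `k`-subsets from sufficiently large sets. -/
theorem Finset.exists_pairwiseDisjoint_subsets_card_eq {V U : Type*} [DecidableEq V]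
    [DecidableEq U] (k : ℕ) (s : Finset V) (R : V → Finset U)
    (h : ∀ v ∈ s, s.card * k ≤ (R v).card) :
    ∃ C : V → Finset U, (∀ v ∈ s, C v ⊆ R v ∧ (C v).card = k) ∧
      ∀ u ∈ s, ∀ v ∈ s, u ≠ v → Disjoint (C u) (C v) := by
  induction s using Finset.induction_on with
  | empty => exact ⟨fun _ => ∅, by simp, by simp⟩
  | insert a s ha ih =>
    rw [Finset.card_insert_of_notMem ha] at h
    obtain ⟨C, hC, hdisj⟩ := ih fun v hv =>
      (Nat.mul_le_mul_right k (Nat.le_succ _)).trans (h v (Finset.mem_insert_of_mem hv))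
    have hcard : (s.biUnion C).card ≤ s.card * k :=
      Finset.card_biUnion_le_card_mul _ _ _ fun v hv => (hC v hv).2.le
    have hfree : k ≤ (R a \ s.biUnion C).card := by
      have h₁ := Finset.le_card_sdiff (s.biUnion C) (R a)
      have h₂ := h a (Finset.mem_insert_self a s)
      rw [add_mul, one_mul] at h₂
      omega
    obtain ⟨B, hB, hBk⟩ := Finset.exists_subset_card_eq hfree
    have hBC : ∀ v ∈ s, Disjoint B (C v) := fun v hv =>
      (Finset.disjoint_of_subset_left hB Finset.sdiff_disjoint).mono_right
        (Finset.subset_biUnion_of_mem C hv)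
    have hne : ∀ v ∈ s, v ≠ a := fun v hv hva => ha (hva ▸ hv)
    refine ⟨Function.update C a B, fun v hv => ?_, fun u hu v hv huv => ?_⟩
    · rcases Finset.mem_insert.1 hv with rfl | hv
      · simpa using ⟨hB.trans Finset.sdiff_subset, hBk⟩
      · simpa [Function.update_of_ne (hne v hv)] using hC v hv
    · rcases Finset.mem_insert.1 hu with rfl | hu <;> rcases Finset.mem_insert.1 hv with rfl | hv
      · exact absurd rfl huv
      · simpa [Function.update_of_ne (hne v hv)] using hBC v hv
      · have hu := Finset.mem_of_mem_insert_of_ne hu huv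
        simpa [Function.update_of_ne (hne u hu)] using (hBC u hu).symm
      · simpa [Function.update_of_ne (hne v hv), Function.update_of_ne (hne u hu)] using
          hdisj u hu v hv huv

/-- A moment bound for the number of points of `A` that a uniformly random function maps
into `D`. -/
theorem sum_half_pow_card_filter_le {U T : Type*} [Fintype U] [Fintype T] [DecidableEq U]
    [DecidableEq T] [Nonempty T] (A : Finset U) (D : Finset T) :
    ∑ f : U → T, (1 / 2 : ℝ) ^ (A.filter fun c => f c ∈ D).card ≤
      (Fintype.card T : ℝ) ^ Fintype.card U *
        Real.exp (-((D.card : ℝ) * A.card / (2 * Fintype.card T))) := by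
  have hT : (0 : ℝ) < Fintype.card T := by exact_mod_cast Fintype.card_pos
  set q : ℝ := Real.exp (-((D.card : ℝ) / (2 * Fintype.card T))) with hq
  have hprod : ∀ f : U → T, (1 / 2 : ℝ) ^ (A.filter fun c => f c ∈ D).card =
      ∏ c, (if c ∈ A ∧ f c ∈ D then (1 / 2 : ℝ) else 1) := by
    intro f
    rw [← Finset.prod_filter, Finset.prod_const]
    congr 2
    ext c
    simp
  have hfactor : ∀ c : U, ∑ t : T, (if c ∈ A ∧ t ∈ D then (1 / 2 : ℝ) else 1) ≤
      Fintype.card T * (if c ∈ A then q else 1) := by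
    intro c
    by_cases hc : c ∈ A
    · have hsum : ∑ t : T, (if t ∈ D then (1 / 2 : ℝ) else 1) =
          Fintype.card T - D.card / 2 := by
        have hsplit : ∀ t : T, (if t ∈ D then (1 / 2 : ℝ) else 1) =
            1 - if t ∈ D then (1 / 2 : ℝ) else 0 := by
          intro t
          split_ifs <;> norm_num
        simp only [hsplit, Finset.sum_sub_distrib, Finset.sum_ite_mem, Finset.univ_inter]
        simp [div_eq_mul_inv]
      simp only [hc, true_and, if_true, hsum]
      have hexp := Real.add_one_le_exp (-((D.card : ℝ) / (2 * Fintype.card T)))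
      calc (Fintype.card T : ℝ) - D.card / 2
          = Fintype.card T * (-((D.card : ℝ) / (2 * Fintype.card T)) + 1) := by
            field_simp
            ring
        _ ≤ Fintype.card T * q := mul_le_mul_of_nonneg_left hexp hT.le
    · simp [hc]
  calc ∑ f : U → T, (1 / 2 : ℝ) ^ (A.filter fun c => f c ∈ D).card
      = ∏ c : U, ∑ t : T, (if c ∈ A ∧ t ∈ D then (1 / 2 : ℝ) else 1) := by
        rw [Finset.prod_univ_sum, Fintype.piFinset_univ]
        exact Finset.sum_congr rfl fun f _ => hprod f
    _ ≤ ∏ c : U, (Fintype.card T * (if c ∈ A then q else 1)) := by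
        refine Finset.prod_le_prod (fun c _ => Finset.sum_nonneg fun t _ => ?_)
          fun c _ => hfactor c
        split_ifs <;> norm_num
    _ = (Fintype.card T : ℝ) ^ Fintype.card U * q ^ A.card := by
        rw [Finset.prod_mul_distrib]
        simp
    _ = _ := by
        rw [hq, ← Real.exp_nat_mul]
        congr 2
        ring

/-- A Chernoff-type bound for the number of functions sending few points of `A` into `D`. -/
theorem card_filter_card_filter_lt_le {U T : Type*} [Fintype U] [Fintype T] [DecidableEq U]
    [DecidableEq T] [Nonempty T] (A : Finset U) (D : Finset T) (j : ℕ) :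
    ((Finset.univ.filter fun f : U → T => (A.filter fun c => f c ∈ D).card < j).card : ℝ) ≤
      (Fintype.card T : ℝ) ^ Fintype.card U *
        (2 ^ j * Real.exp (-((D.card : ℝ) * A.card / (2 * Fintype.card T)))) := by
  rw [Finset.natCast_card_filter]
  calc ∑ f : U → T, (if (A.filter fun c => f c ∈ D).card < j then (1 : ℝ) else 0)
      ≤ ∑ f : U → T, 2 ^ j * (1 / 2 : ℝ) ^ (A.filter fun c => f c ∈ D).card := by
        refine Finset.sum_le_sum fun f _ => ?_
        split_ifs with hf
        · rw [one_div, inv_pow, ← div_eq_mul_inv, one_le_div (by positivity)]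
          exact pow_le_pow_right₀ (by norm_num) hf.le
        · positivity
    _ ≤ _ := by
        rw [← Finset.mul_sum, mul_left_comm]
        exact mul_le_mul_of_nonneg_left (sum_half_pow_card_filter_le A D) (by positivity)

/-- If lists of size `n` are large enough, then there is an assignment of the colors to the
parts, with some colors held in reserve, such that at most `r` vertices get fewer than `k`
colors of their own part while every vertex sees at least `r * k` reserved colors. -/
theorem exists_color_assignment {V U : Type*} [Fintype V] [Fintype U] [DecidableEq U]
    {r : ℕ} (hr : 1 ≤ r) (n k : ℕ) (P : V → Fin r) (S : V → Finset U)
    (hS : ∀ v, (S v).card = n)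
    (hn : (Fintype.card V : ℝ) * (2 ^ k * Real.exp (-((n : ℝ) / (4 * r)))) / r +
      Fintype.card V * (2 ^ k * Real.exp (-((n : ℝ) / (4 * r)))) ^ r < 1) :
    ∃ f : U → Bool × Fin r,
      (Finset.univ.filter fun v => ((S v).filter fun c => f c = (false, P v)).card < k).card ≤ r ∧
      ∀ v, r * k ≤ ((S v).filter fun c => (f c).1 = true).card := by
  have : Nonempty (Bool × Fin r) := ⟨(true, ⟨0, hr⟩)⟩
  have hr0 : (0 : ℝ) < r := by exact_mod_cast hr
  set N : ℝ := (Fintype.card (Bool × Fin r) : ℝ) ^ Fintype.card U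
  set y : ℝ := 2 ^ k * Real.exp (-((n : ℝ) / (4 * r))) with hy
  have hN : 0 < N := by
    have : 0 < Fintype.card (Bool × Fin r) := Fintype.card_pos
    positivity
  have hcardT : (Fintype.card (Bool × Fin r) : ℝ) = 2 * r := by simp
  have hown : ∀ v, ((Finset.univ.filter fun f : U → Bool × Fin r =>
      ((S v).filter fun c => f c = (false, P v)).card < k).card : ℝ) ≤ N * y := by
    intro v
    have h := card_filter_card_filter_lt_le (S v) {((false, P v) : Bool × Fin r)} k
    simp only [Finset.mem_singleton, Finset.card_singleton, hS v] at h
    refine h.trans_eq ?_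
    have hexp : (((1 : ℕ) : ℝ) * n / (2 * (Fintype.card (Bool × Fin r) : ℝ))) = n / (4 * r) := by
      rw [hcardT, Nat.cast_one, one_mul, ← mul_assoc]
      norm_num
    rw [hexp]
  have hreserve : ∀ v, ((Finset.univ.filter fun f : U → Bool × Fin r =>
      ((S v).filter fun c => (f c).1 = true).card < r * k).card : ℝ) ≤ N * y ^ r := by
    intro v
    have h := card_filter_card_filter_lt_le (S v)
      (({true} : Finset Bool) ×ˢ (Finset.univ : Finset (Fin r))) (r * k)
    simp only [Finset.mem_product, Finset.mem_singleton, Finset.mem_univ, and_true,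
      Finset.card_product, Finset.card_singleton, Finset.card_univ, Fintype.card_fin,
      one_mul, hS v] at h
    refine h.trans_eq ?_
    have hexp : -((r : ℝ) * n / (2 * (Fintype.card (Bool × Fin r) : ℝ))) =
        r * -((n : ℝ) / (4 * r)) := by
      rw [hcardT]
      field_simp
      ring
    rw [hexp, Real.exp_nat_mul, mul_comm r k, pow_mul, ← mul_pow]
  by_contra! hcon
  have hone : ∀ f : U → Bool × Fin r, (1 : ℝ) ≤
      (∑ v, if ((S v).filter fun c => f c = (false, P v)).card < k then (1 : ℝ) else 0) / r +
        ∑ v, if ((S v).filter fun c => (f c).1 = true).card < r * k then (1 : ℝ) else 0 := by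
    intro f
    have hnn : ∀ p : V → Prop, ∀ [DecidablePred p],
        (0 : ℝ) ≤ ∑ v, if p v then (1 : ℝ) else 0 := fun p _ =>
      Finset.sum_nonneg fun v _ => by split_ifs <;> norm_num
    by_cases hf : (Finset.univ.filter fun v =>
        ((S v).filter fun c => f c = (false, P v)).card < k).card ≤ r
    · obtain ⟨v, hv⟩ := hcon f hf
      have h₁ : (1 : ℝ) ≤
          ∑ v, if ((S v).filter fun c => (f c).1 = true).card < r * k then (1 : ℝ) else 0 := by
        rw [← Finset.natCast_card_filter]
        exact_mod_cast Finset.card_pos.2 ⟨v, by simpa using hv⟩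
      exact h₁.trans (le_add_of_nonneg_left (div_nonneg (hnn _) hr0.le))
    · refine le_trans ?_ (le_add_of_nonneg_right (hnn _))
      rw [← Finset.natCast_card_filter, one_le_div hr0]
      exact_mod_cast (not_le.1 hf).le
  have hsum : N ≤ N * (Fintype.card V * y / r + Fintype.card V * y ^ r) := by
    calc N = ∑ _f : U → Bool × Fin r, (1 : ℝ) := by simp [N]
      _ ≤ _ := Finset.sum_le_sum fun f _ => hone f
      _ = (∑ v, ((Finset.univ.filter fun f : U → Bool × Fin r =>
              ((S v).filter fun c => f c = (false, P v)).card < k).card : ℝ)) / r +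
            ∑ v, ((Finset.univ.filter fun f : U → Bool × Fin r =>
              ((S v).filter fun c => (f c).1 = true).card < r * k).card : ℝ) := by
        rw [Finset.sum_add_distrib, ← Finset.sum_div, Finset.sum_comm]
        congr 1
        · simp only [Finset.natCast_card_filter]
        · rw [Finset.sum_comm]
          simp only [Finset.natCast_card_filter]
      _ ≤ (∑ _v : V, N * y) / r + ∑ _v : V, N * y ^ r := by
        gcongr with v _ v _
        · exact hown v
        · exact hreserve v
      _ = _ := by
        simp only [Finset.sum_const, Finset.card_univ, nsmul_eq_mul]
        ring
  nlinarith

/-- A sufficient condition for choosing `k` colors from lists of size `n` so that vertices in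
different parts get disjoint sets of colors. -/
theorem exists_choice_of_card_mul_lt_one {V U : Type*} [Fintype V] [Fintype U] [DecidableEq V]
    [DecidableEq U] {r : ℕ} (hr : 1 ≤ r) (n k : ℕ) (P : V → Fin r) (S : V → Finset U)
    (hS : ∀ v, (S v).card = n)
    (hn : (Fintype.card V : ℝ) * (2 ^ k * Real.exp (-((n : ℝ) / (4 * r)))) / r +
      Fintype.card V * (2 ^ k * Real.exp (-((n : ℝ) / (4 * r)))) ^ r < 1) :
    ∃ C : V → Finset U, (∀ v, C v ⊆ S v) ∧ (∀ v, (C v).card = k) ∧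
      ∀ u v, P u ≠ P v → Disjoint (C u) (C v) := by
  obtain ⟨f, hbad, hres⟩ := exists_color_assignment hr n k P S hS hn
  set B := Finset.univ.filter fun v => ((S v).filter fun c => f c = (false, P v)).card < k
  obtain ⟨C, hC, hCdisj⟩ := Finset.exists_pairwiseDisjoint_subsets_card_eq k B
    (fun v => (S v).filter fun c => (f c).1 = true)
    fun v _ => (Nat.mul_le_mul_right k hbad).trans (hres v)
  have hgood : ∀ v, ∃ D : Finset U, v ∉ B →
      D ⊆ ((S v).filter fun c => f c = (false, P v)) ∧ D.card = k := by
    intro v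
    by_cases hv : v ∈ B
    · exact ⟨∅, fun h => absurd hv h⟩
    · obtain ⟨D, hD⟩ := Finset.exists_subset_card_eq (by simpa [B] using hv)
      exact ⟨D, fun _ => hD⟩
  choose D hD using hgood
  have hCD : ∀ u v, u ∈ B → v ∉ B → Disjoint (C u) (D v) := fun u v hu hv =>
    Finset.disjoint_left.2 fun c hcu hcv => by
      have h₁ := (Finset.mem_filter.1 ((hC u hu).1 hcu)).2
      have h₂ := (Finset.mem_filter.1 ((hD v hv).1 hcv)).2
      simp [h₂] at h₁
  refine ⟨fun v => if v ∈ B then C v else D v, fun v => ?_, fun v => ?_, fun u v huv => ?_⟩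
  · dsimp only
    split_ifs with hv
    · exact (hC v hv).1.trans (Finset.filter_subset _ _)
    · exact (hD v hv).1.trans (Finset.filter_subset _ _)
  · dsimp only
    split_ifs with hv
    · exact (hC v hv).2
    · exact (hD v hv).2
  · dsimp only
    split_ifs with hu hv hv
    · exact hCdisj u hu v hv fun h => huv (congrArg P h)
    · exact hCD u v hu hv
    · exact (hCD v u hv hu).symm
    · refine Finset.disjoint_left.2 fun c hcu hcv => huv ?_
      have h₁ := (Finset.mem_filter.1 ((hD u hu).1 hcu)).2
      have h₂ := (Finset.mem_filter.1 ((hD v hv).1 hcv)).2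
      simpa using h₁.symm.trans h₂

/-- A sufficient condition for a complete multipartite graph to be `(n:k)`-choosable. -/
theorem SimpleGraph.choosable_completeMultipartiteGraph {r : ℕ} (hr : 1 ≤ r) (m : Fin r → ℕ)
    (n k : ℕ)
    (hn : ((∑ i, m i : ℕ) : ℝ) * (2 ^ k * Real.exp (-((n : ℝ) / (4 * r)))) / r +
      (∑ i, m i : ℕ) * (2 ^ k * Real.exp (-((n : ℝ) / (4 * r)))) ^ r < 1) :
    (SimpleGraph.completeMultipartiteGraph (fun i : Fin r => Fin (m i))).Choosable n k := by
  intro S hS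
  set W := Finset.univ.biUnion S
  have hSW : ∀ v, ∀ c ∈ S v, c ∈ W := fun v c hc =>
    Finset.mem_biUnion.2 ⟨v, Finset.mem_univ v, hc⟩
  obtain ⟨C, hC, hCk, hCdisj⟩ := exists_choice_of_card_mul_lt_one (U := W) hr n k
    (fun v : (i : Fin r) × Fin (m i) => v.1) (fun v => (S v).subtype (· ∈ W))
    (fun v => by
      rw [Finset.card_subtype, Finset.filter_true_of_mem (hSW v), hS v])
    (by simpa using hn)
  refine ⟨fun v => (C v).map (Function.Embedding.subtype _), fun v => ?_, fun v => ?_,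
    fun u v huv => ?_⟩
  · intro c hc
    obtain ⟨c, hcC, rfl⟩ := Finset.mem_map.1 hc
    exact Finset.mem_subtype.1 (hC v hcC)
  · rw [Finset.card_map, hCk v]
  · exact (Finset.disjoint_map _).2 (hCdisj u v huv)

theorem kth_choice_number_completeMultipartite_le (r : ℕ) (hr : 1 ≤ r)
    (m : Fin r → ℕ) (hm : ∀ i, 2 ≤ m i) (k : ℕ) (hk : 1 ≤ k) :
    ((SimpleGraph.completeMultipartiteGraph (fun i : Fin r => Fin (m i))).chooseNum k : ℝ) ≤
      948 * (r : ℝ) * ((k : ℝ) + Real.log ((∑ i, (m i : ℝ)) / (r : ℝ))) := by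
  have hr1 : (1 : ℝ) ≤ r := by exact_mod_cast hr
  have hk1 : (1 : ℝ) ≤ k := by exact_mod_cast hk
  have hr0 : (0 : ℝ) < r := by linarith
  set a : ℝ := (∑ i, (m i : ℝ)) / r with ha
  have ha1 : 1 ≤ a := by
    rw [ha, one_le_div hr0]
    calc (r : ℝ) = ∑ _i : Fin r, (1 : ℝ) := by simp
      _ ≤ ∑ i, (m i : ℝ) := Finset.sum_le_sum fun i _ => by
        exact_mod_cast one_le_two.trans (hm i)
  have ha0 : 0 < a := by linarith
  have hlog : 0 ≤ Real.log a := Real.log_nonneg ha1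
  set L : ℝ := k + Real.log a with hL
  have hrL : 1 ≤ r * L := by nlinarith
  set n : ℕ := ⌈12 * (r * L)⌉₊
  have hn : 12 * (r * L) ≤ n := Nat.le_ceil _
  have hn' : (n : ℝ) < 12 * (r * L) + 1 := Nat.ceil_lt_add_one (by linarith)
  set y : ℝ := 2 ^ k * Real.exp (-((n : ℝ) / (4 * r))) with hy
  have hy0 : 0 ≤ y := by positivity
  have hexp1 : (2 : ℝ) ≤ Real.exp 1 := by linarith [Real.add_one_le_exp (1 : ℝ)]
  have hya : y ≤ 1 / (4 * a) := by
    have h3L : 3 * L ≤ (n : ℝ) / (4 * r) := by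
      rw [le_div_iff₀ (by positivity)]
      linarith
    have h4 : (4 : ℝ) ≤ Real.exp 2 := by
      rw [show (2 : ℝ) = 1 + 1 by norm_num, Real.exp_add]
      nlinarith
    calc y ≤ Real.exp k * Real.exp (-(3 * L)) := by
          rw [hy, ← Real.exp_one_pow]
          gcongr
      _ = Real.exp (k - 3 * L) := by rw [← Real.exp_add, sub_eq_add_neg]
      _ ≤ Real.exp (-(2 + Real.log a)) := Real.exp_le_exp.2 (by linarith)
      _ = 1 / (Real.exp 2 * a) := by
          rw [Real.exp_neg, Real.exp_add, Real.exp_log ha0, one_div]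
      _ ≤ 1 / (4 * a) := by gcongr
  have hay : a * y ≤ 1 / 4 := by
    calc a * y ≤ a * (1 / (4 * a)) := by gcongr
      _ = 1 / 4 := by field_simp
  have hy4 : y ≤ 1 / 4 := by nlinarith
  have hM : ((∑ i, m i : ℕ) : ℝ) = r * a := by
    rw [ha]
    push_cast
    field_simp
  have hchoose :
      (SimpleGraph.completeMultipartiteGraph (fun i : Fin r => Fin (m i))).Choosable n k := by
    refine SimpleGraph.choosable_completeMultipartiteGraph hr m n k ?_
    rw [← hy, hM]
    have hown : r * a * y / r ≤ 1 / 4 := by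
      rw [mul_assoc, mul_div_cancel_left₀ _ hr0.ne']
      exact hay
    have hreserve : r * a * y ^ r ≤ 1 / 2 := by
      obtain ⟨s, rfl⟩ : ∃ s, r = s + 1 := ⟨r - 1, by omega⟩
      have hs : ((s + 1 : ℕ) : ℝ) ≤ 2 ^ s := by exact_mod_cast Nat.lt_two_pow_self
      calc ((s + 1 : ℕ) : ℝ) * a * y ^ (s + 1) = ((s + 1 : ℕ) : ℝ) * y ^ s * (a * y) := by ring
        _ ≤ 2 ^ s * (1 / 4) ^ s * (1 / 4) := by gcongr
        _ = (1 / 2) ^ s * (1 / 4) := by rw [← mul_pow]; norm_num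
        _ ≤ 1 * (1 / 4) := by
          gcongr
          exact pow_le_one₀ (by norm_num) (by norm_num)
        _ ≤ 1 / 2 := by norm_num
    linarith
  have hle : (SimpleGraph.completeMultipartiteGraph
      (fun i : Fin r => Fin (m i))).chooseNum k ≤ n := Nat.sInf_le hchoose
  calc _ ≤ (n : ℝ) := by exact_mod_cast hle
    _ ≤ 948 * r * L := by linarith
end

section
/- If a finite connected simple graph G is not a complete graph and not an odd cycle, then ch_k(G) ≤ k·Δ(G) for every positive integer k, where Δ(G) is the maximum degree of G. -/
namespace SimpleGraph

variable {V : Type*} {G : SimpleGraph V} {S : V → Finset ℕ} {k d : ℕ}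

/-- `c` is a `k`-fold list coloring of the subgraph of `G` induced on `A`. -/
def IsPartialColoring (G : SimpleGraph V) (S : V → Finset ℕ) (k : ℕ) (A : Finset V)
    (c : V → Finset ℕ) : Prop :=
  (∀ v ∈ A, c v ⊆ S v ∧ (c v).card = k) ∧ ∀ u ∈ A, ∀ v ∈ A, G.Adj u v → Disjoint (c u) (c v)

section Greedy

variable [DecidableEq V] {A : Finset V} {c : V → Finset ℕ}

theorem IsPartialColoring.update (h : G.IsPartialColoring S k A c) {v : V} (hv : v ∉ A)
    {D : Finset ℕ} (hD : D ⊆ S v) (hk : D.card = k)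
    (hdisj : ∀ u ∈ A, G.Adj v u → Disjoint D (c u)) :
    G.IsPartialColoring S k (insert v A) (Function.update c v D) := by
  have hupd : ∀ u ∈ A, Function.update c v D u = c u := fun u hu =>
    Function.update_of_ne (ne_of_mem_of_not_mem hu hv) _ _
  refine ⟨fun w hw => ?_, fun u hu w hw huw => ?_⟩
  · rcases Finset.mem_insert.1 hw with rfl | hw
    · simpa using ⟨hD, hk⟩
    · rw [hupd w hw]
      exact h.1 w hw
  · rcases Finset.mem_insert.1 hu with rfl | hu' <;> rcases Finset.mem_insert.1 hw with rfl | hw'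
    · exact (G.irrefl huw).elim
    · rw [hupd w hw', Function.update_self]
      exact hdisj w hw' huw
    · rw [hupd u hu', Function.update_self]
      exact (hdisj u hu' huw.symm).symm
    · rw [hupd u hu', hupd w hw']
      exact h.2 u hu' w hw' huw

/-- A vertex whose available list outside a set `X` of blocked colors is large enough can be
colored. -/
theorem IsPartialColoring.exists_insert (h : G.IsPartialColoring S k A c) {v : V} (hv : v ∉ A)
    (X : Finset ℕ) (hX : ∀ u ∈ A, G.Adj v u → c u ∩ S v ⊆ X) (hcard : X.card + k ≤ (S v).card) :
    ∃ c', G.IsPartialColoring S k (insert v A) c' ∧ ∀ u ∈ A, c' u = c u := by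
  have h1 : k ≤ (S v \ X).card := by
    have := Finset.le_card_sdiff X (S v)
    omega
  obtain ⟨D, hD, hDk⟩ := Finset.exists_subset_card_eq h1
  refine ⟨Function.update c v D, h.update hv (hD.trans Finset.sdiff_subset) hDk ?_, ?_⟩
  · intro u hu huv
    rw [Finset.disjoint_left]
    intro a ha hau
    have ha' := Finset.mem_sdiff.1 (hD ha)
    exact ha'.2 (hX u hu huv (Finset.mem_inter.2 ⟨hau, ha'.1⟩))
  · intro u hu
    exact Function.update_of_ne (ne_of_mem_of_not_mem hu hv) _ _

variable [Fintype V] [DecidableRel G.Adj]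

theorem IsPartialColoring.exists_insert_of_card_lt (h : G.IsPartialColoring S k A c)
    (hS : ∀ v, (S v).card = k * d) {v : V} (hv : v ∉ A)
    (hlt : (G.neighborFinset v ∩ A).card < d) :
    ∃ c', G.IsPartialColoring S k (insert v A) c' ∧ ∀ u ∈ A, c' u = c u := by
  refine h.exists_insert hv ((G.neighborFinset v ∩ A).biUnion c) (fun u hu huv a ha => ?_) ?_
  · exact Finset.mem_biUnion.2 ⟨u, by simpa using ⟨huv, hu⟩, (Finset.mem_inter.1 ha).1⟩
  · have h1 : ((G.neighborFinset v ∩ A).biUnion c).card ≤ (G.neighborFinset v ∩ A).card * k :=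
      Finset.card_biUnion_le_card_mul _ _ _
        fun u hu => (h.1 u (Finset.mem_inter.1 hu).2).2.le
    rw [hS]
    nlinarith

/-- Greedy coloring along a rank function: if every vertex outside `A ∪ T` has an uncolored
neighbor of smaller rank, then the coloring of `A` extends to all vertices outside `T`. -/
theorem IsPartialColoring.exists_greedy (hS : ∀ v, (S v).card = k * d)
    (hd : ∀ v, G.degree v ≤ d) (T : Finset V) (r : V → ℕ) (A : Finset V) (c : V → Finset ℕ)
    (h : G.IsPartialColoring S k A c)
    (hr : ∀ v ∉ A, v ∉ T → ∃ u ∉ A, G.Adj v u ∧ r u < r v) :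
    ∃ c', G.IsPartialColoring S k (A ∪ Tᶜ) c' ∧ ∀ u ∈ A, c' u = c u := by
  induction hn : ((A ∪ T)ᶜ).card generalizing A c with
  | zero =>
    refine ⟨c, ?_, fun _ _ => rfl⟩
    have hsub : A ∪ Tᶜ = A := by
      ext v
      have : v ∉ (A ∪ T)ᶜ := by simp [Finset.card_eq_zero.1 hn]
      simp only [Finset.mem_compl, Finset.mem_union] at this ⊢
      tauto
    rwa [hsub]
  | succ n ih =>
    have hne : ((A ∪ T)ᶜ).Nonempty := Finset.card_pos.1 (by omega)
    obtain ⟨v, hv, hmax⟩ := Finset.exists_max_image _ r hne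
    have hv' := hv
    simp only [Finset.mem_compl, Finset.mem_union, not_or] at hv'
    obtain ⟨u, huA, hvu, -⟩ := hr v hv'.1 hv'.2
    have hlt : (G.neighborFinset v ∩ A).card < d := by
      refine lt_of_lt_of_le (Finset.card_lt_card ?_) (hd v)
      refine (Finset.ssubset_iff_of_subset Finset.inter_subset_left).2 ⟨u, by simpa using hvu, ?_⟩
      simp [huA]
    obtain ⟨c₁, hc₁, hcA⟩ := h.exists_insert_of_card_lt hS hv'.1 hlt
    obtain ⟨c₂, hc₂, hcA₂⟩ := ih (insert v A) c₁ hc₁ (by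
      intro w hw hwT
      have hw' : w ≠ v ∧ w ∉ A := by simpa using hw
      obtain ⟨z, hz, hwz, hlt⟩ := hr w hw'.2 hwT
      have hle := hmax w (by simp [hw'.2, hwT])
      refine ⟨z, ?_, hwz, hlt⟩
      simp only [Finset.mem_insert, not_or]
      refine ⟨?_, hz⟩
      rintro rfl
      omega) (by
      have : (insert v A ∪ T)ᶜ = ((A ∪ T)ᶜ).erase v := by
        ext w
        simp
      rw [this, Finset.card_erase_of_mem hv, hn]
      rfl)
    refine ⟨c₂, ?_, fun u hu => ?_⟩
    · have : insert v A ∪ Tᶜ = A ∪ Tᶜ := by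
        ext w
        simp only [Finset.mem_union, Finset.mem_insert, Finset.mem_compl]
        have := hv'.2
        grind
      rwa [this] at hc₂
    · rw [hcA₂ u (Finset.mem_insert_of_mem hu), hcA u hu]

/-- In a connected graph, everything outside a nonempty set can be colored greedily. -/
theorem Connected.exists_isPartialColoring_compl (hG : G.Connected)
    (hS : ∀ v, (S v).card = k * d) (hd : ∀ v, G.degree v ≤ d) (T : Finset V) {t : V}
    (ht : t ∈ T) : ∃ c, G.IsPartialColoring S k Tᶜ c := by
  obtain ⟨c, hc, -⟩ := IsPartialColoring.exists_greedy (G := G) (S := S) (k := k) hS hd T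
    (fun v => G.dist v t) ∅ (fun _ => ∅) ⟨by simp, by simp⟩ (by
      intro v _ hvT
      obtain ⟨p, hp⟩ := hG.exists_walk_length_eq_dist v t
      cases p with
      | nil => exact (hvT ht).elim
      | cons hadj q =>
        refine ⟨_, Finset.notMem_empty _, hadj, ?_⟩
        have := dist_le q
        simp only [Walk.length_cons] at hp
        omega)
  exact ⟨c, by simpa using hc⟩

end Greedy

theorem IsPartialColoring.exists_coloring {A : Finset V} {c : V → Finset ℕ}
    (h : G.IsPartialColoring S k A c) (hA : ∀ v, v ∈ A) :
    ∃ C : V → Finset ℕ, (∀ v, C v ⊆ S v) ∧ (∀ v, (C v).card = k) ∧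
      ∀ u v, G.Adj u v → Disjoint (C u) (C v) :=
  ⟨c, fun v => (h.1 v (hA v)).1, fun v => (h.1 v (hA v)).2, fun u v => h.2 u (hA u) v (hA v)⟩

/-- A connected graph with a vertex of degree less than `d` is `(k * d : k)`-choosable. -/
theorem Connected.choosable_of_degree_lt [Fintype V] [DecidableRel G.Adj] (hG : G.Connected)
    (hd : ∀ v, G.degree v ≤ d) {x : V} (hx : G.degree x < d) : G.Choosable (k * d) k := by
  classical
  intro S hS
  obtain ⟨c, hc⟩ := hG.exists_isPartialColoring_compl hS hd {x} (Finset.mem_singleton_self x)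
  obtain ⟨c', hc', -⟩ := hc.exists_insert_of_card_lt hS (v := x) (by simp)
    ((Finset.card_le_card Finset.inter_subset_left).trans_lt hx)
  exact hc'.exists_coloring (fun v => by simp)

/-- Given lists `D` and `L` of equal size and a set `X` of at most `k` colors, one can choose `k`
colors from `D` so that these and `X` together block at most `k` colors of `L`. -/
theorem exists_subset_card_inter_union_le {D L X : Finset ℕ} (hDL : D.card = L.card)
    (hk : k ≤ D.card) (hX : X.card ≤ k) :
    ∃ C ⊆ D, C.card = k ∧ (L ∩ (X ∪ C)).card ≤ k := by
  set Y := L ∩ X with hY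
  have hYk : Y.card ≤ k := (Finset.card_le_card Finset.inter_subset_right).trans hX
  set E := (D \ L) ∪ (Y ∩ D) with hE
  have hED : E ⊆ D := Finset.union_subset Finset.sdiff_subset Finset.inter_subset_right
  have hsd : (D \ L).card = (L \ D).card := Finset.card_sdiff_comm hDL
  have hYE : Y.card ≤ E.card := by
    have h1 : Disjoint (D \ L) (Y ∩ D) := by
      rw [Finset.disjoint_left]
      intro a ha hb
      simp only [hY, Finset.mem_sdiff, Finset.mem_inter] at ha hb
      tauto
    have h2 : (Y \ D).card ≤ (L \ D).card :=
      Finset.card_le_card (Finset.sdiff_subset_sdiff Finset.inter_subset_left le_rfl)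
    have h3 := Finset.card_sdiff_add_card_inter Y D
    rw [hE, Finset.card_union_of_disjoint h1]
    omega
  obtain ⟨E', hE', hE'c⟩ := Finset.exists_subset_card_eq hYE
  obtain ⟨C, hEC, hCD, hC⟩ := Finset.exists_subsuperset_card_eq (hE'.trans hED)
    (hE'c.trans_le hYk) hk
  refine ⟨C, hCD, hC, ?_⟩
  have hsub : L ∩ (X ∪ C) ⊆ Y ∪ (C \ E') := by
    intro a ha
    simp only [Finset.mem_inter, Finset.mem_union, Finset.mem_sdiff, hY] at ha ⊢
    by_cases haE : a ∈ E'
    · have := hE' haE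
      simp only [hE, Finset.mem_inter, Finset.mem_union, Finset.mem_sdiff, hY] at this
      tauto
    · tauto
  have h4 := (Finset.card_le_card hsub).trans (Finset.card_union_le _ _)
  have h5 := Finset.card_sdiff_add_card_eq_card hEC
  omega

/-- Let `K` be a set of vertices avoiding `y`, containing all neighbors of `y`, and connected
towards a neighbor `x` of `y` as witnessed by the rank function `r`. If `x` has a neighbor `u`
outside `K ∪ {y}`, then lists of size `k * d` suffice. -/
theorem Connected.choosable_of_exists_rank [Fintype V] [DecidableRel G.Adj] (hG : G.Connected)
    (hd : ∀ v, G.degree v ≤ d) (K : Finset V) {x y u : V} (hxK : x ∈ K) (hyK : y ∉ K)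
    (huK : u ∉ K) (huy : u ≠ y) (hxy : G.Adj x y) (hxu : G.Adj x u)
    (hN : ∀ v, G.Adj y v → v ∈ K) (r : V → ℕ)
    (hr : ∀ v ∈ K, v ≠ x → ∃ w ∈ K, G.Adj v w ∧ r w < r v) : G.Choosable (k * d) k := by
  classical
  intro S hS
  have hd2 : 2 ≤ d := by
    refine le_trans ?_ (hd x)
    rw [← card_neighborFinset_eq_degree, ← Finset.card_pair huy]
    refine Finset.card_le_card ?_
    simp [Finset.insert_subset_iff, hxy, hxu]
  obtain ⟨c, hc⟩ := hG.exists_isPartialColoring_compl hS hd (insert y K)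
    (Finset.mem_insert_self y K)
  have hu : u ∈ (insert y K)ᶜ := by simp [huy, huK]
  obtain ⟨D, hDS, hDk, hDx⟩ := exists_subset_card_inter_union_le (D := S y) (L := S x) (X := c u)
    (k := k) (by rw [hS, hS]) (by rw [hS]; nlinarith) (hc.1 u hu).2.le
  have hc₁ := hc.update (v := y) (D := D) (by simp) hDS hDk (by
    intro v hv hyv
    have := hN v hyv
    simp_all)
  have hA : insert y (insert y K)ᶜ = Kᶜ := by
    ext v
    simp only [Finset.mem_insert, Finset.mem_compl]
    grind
  rw [hA] at hc₁
  obtain ⟨c₂, hc₂, heq⟩ := IsPartialColoring.exists_greedy hS hd {x} r _ _ hc₁ (by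
    intro v hv hvx
    simp only [Finset.mem_compl, not_not, Finset.mem_singleton] at hv hvx ⊢
    exact hr v hv hvx)
  have hA₂ : Kᶜ ∪ {x}ᶜ = ({x}ᶜ : Finset V) := by
    ext v
    simp only [Finset.mem_union, Finset.mem_compl, Finset.mem_singleton]
    grind
  rw [hA₂] at hc₂
  have h2u : c₂ u = c u := by
    rw [heq u (by simpa using huK), Function.update_of_ne huy]
  have h2y : c₂ y = D := by
    rw [heq y (by simpa using hyK), Function.update_self]
  set N := ((G.neighborFinset x).erase u).erase y with hNdef
  have hNx : ∀ v ∈ N, v ∈ ({x}ᶜ : Finset V) := by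
    intro v hv
    have : G.Adj x v := by simp [hNdef] at hv; tauto
    simpa using this.ne'
  have hNc : N.card + 2 ≤ d := by
    have h1 : (G.neighborFinset x).card ≤ d := hd x
    have hmu : u ∈ G.neighborFinset x := by simpa using hxu
    have hmy : y ∈ (G.neighborFinset x).erase u := by simpa [huy.symm] using hxy
    have h2 := Finset.card_erase_add_one hmu
    have h3 := Finset.card_erase_add_one hmy
    rw [hNdef]
    omega
  obtain ⟨c₃, hc₃, -⟩ := hc₂.exists_insert (v := x) (by simp)
    (N.biUnion c₂ ∪ (S x ∩ (c u ∪ D))) (by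
      intro v _ hxv a ha
      rw [Finset.mem_inter] at ha
      by_cases hvu : v = u
      · subst hvu
        simp [ha.2, ← h2u, ha.1]
      by_cases hvy : v = y
      · subst hvy
        simp [ha.2, ← h2y, ha.1]
      refine Finset.mem_union_left _ (Finset.mem_biUnion.2 ⟨v, ?_, ha.1⟩)
      simp [hNdef, hvu, hvy, hxv]) (by
      have h1 : (N.biUnion c₂).card ≤ N.card * k :=
        Finset.card_biUnion_le_card_mul _ _ _ fun v hv => (hc₂.1 v (hNx v hv)).2.le
      have h2 := Finset.card_union_le (N.biUnion c₂) (S x ∩ (c u ∪ D))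
      rw [hS]
      nlinarith)
  exact hc₃.exists_coloring (fun v => by simp)

/-- Every set of vertices in a functional digraph without odd cycles has a kernel. -/
theorem exists_kernel [DecidableEq V] (f : V → V) (p : V → Prop) (hp : ∀ v, p (f v) ↔ ¬ p v) (W : Finset V) :
    ∃ K ⊆ W, (∀ v ∈ K, f v ∉ K) ∧ ∀ v ∈ W, v ∉ K → f v ∈ K := by
  classical
  induction W using Finset.strongInduction with
  | H W ih =>
    by_cases hsink : ∃ w ∈ W, f w ∉ W
    · obtain ⟨w, hw, hfw⟩ := hsink
      obtain ⟨K, hKW, hind, habs⟩ := ih {v ∈ W | v ≠ w ∧ f v ≠ w}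
        (Finset.filter_ssubset.2 ⟨w, hw, by simp⟩)
      refine ⟨insert w K, ?_, ?_, ?_⟩
      · exact Finset.insert_subset hw (hKW.trans (Finset.filter_subset _ _))
      · intro v hv
        simp only [Finset.mem_insert, not_or]
        rcases Finset.mem_insert.1 hv with rfl | hv
        · exact ⟨fun e => hfw (e.symm ▸ hw), fun h => hfw (Finset.mem_filter.1 (hKW h)).1⟩
        · exact ⟨(Finset.mem_filter.1 (hKW hv)).2.2, hind v hv⟩
      · intro v hv hvK
        simp only [Finset.mem_insert, not_or] at hvK ⊢
        by_cases hfv : f v = w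
        · exact Or.inl hfv
        · exact Or.inr (habs v (by simp [hv, hvK.1, hfv]) hvK.2)
    · push Not at hsink
      refine ⟨{v ∈ W | p v}, Finset.filter_subset _ _, ?_, ?_⟩
      · intro v hv
        have := (Finset.mem_filter.1 hv).2
        simp [hp, this]
      · intro v hv hvK
        have : ¬ p v := fun h => hvK (by simp [hv, h])
        simp [hsink v hv, hp, this]

/-- Kernel method for a graph oriented along a function without odd cycles, with demands `g`. -/
theorem exists_coloring_of_function [Fintype V] [DecidableEq V] (f : V → V) (p : V → Prop)
    (hp : ∀ v, p (f v) ↔ ¬ p v)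
    (hf : ∀ u v, G.Adj u v → v = f u ∨ u = f v) (U : Finset ℕ) (S : V → Finset ℕ) (g : V → ℕ)
    (hSU : ∀ v, S v ⊆ U) (hg : ∀ v, 0 < g v → g v + g (f v) ≤ (S v).card) :
    ∃ C : V → Finset ℕ, (∀ v, C v ⊆ S v) ∧ (∀ v, (C v).card = g v) ∧
      ∀ u v, G.Adj u v → Disjoint (C u) (C v) := by
  induction U using Finset.induction_on generalizing S g with
  | empty =>
    refine ⟨fun _ => ∅, by simp, fun v => ?_, by simp⟩
    have h0 : S v = ∅ := Finset.subset_empty.1 (hSU v)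
    by_contra hne
    have := hg v (by simp at hne; omega)
    simp only [h0, Finset.card_empty] at this hne
    omega
  | insert a U ha ih =>
    obtain ⟨K, hKW, hind, habs⟩ := exists_kernel f p hp {v : V | a ∈ S v ∧ 0 < g v}
    have hK : ∀ v ∈ K, a ∈ S v ∧ 0 < g v := fun v hv => by simpa using hKW hv
    obtain ⟨C, hCS, hCg, hCd⟩ := ih (fun v => (S v).erase a)
      (fun v => if v ∈ K then g v - 1 else g v)
      (fun v => by
        have := Finset.erase_subset_erase a (hSU v)
        rwa [Finset.erase_insert ha] at this)
      (fun v hv => by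
        have hgv : 0 < g v := by
          split_ifs at hv <;> omega
        have h1 := hg v hgv
        by_cases haS : a ∈ S v
        · have h2 := Finset.card_erase_add_one haS
          by_cases hvK : v ∈ K
          · simp only [hvK, if_true]
            split_ifs <;> omega
          · have h3 := habs v (by simp [haS, hgv]) hvK
            have := (hK _ h3).2
            simp only [hvK, h3, if_true, if_false]
            omega
        · have hvK : v ∉ K := fun h => haS (hK v h).1
          rw [Finset.erase_eq_of_notMem haS]
          simp only [hvK, if_false]
          split_ifs <;> omega)
    have haC : ∀ v, a ∉ C v := fun v h => by simpa using hCS v h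
    have hKadj : ∀ u ∈ K, ∀ v ∈ K, ¬ G.Adj u v := by
      intro u hu v hv huv
      rcases hf u v huv with rfl | rfl
      · exact hind _ hu hv
      · exact hind _ hv hu
    refine ⟨fun v => if v ∈ K then insert a (C v) else C v, fun v => ?_, fun v => ?_,
      fun u v huv => ?_⟩
    · have h1 := (hCS v).trans (Finset.erase_subset _ _)
      dsimp only
      split_ifs with hv
      · exact Finset.insert_subset (hK v hv).1 h1
      · exact h1
    · have h1 := hCg v
      dsimp only
      split_ifs with hv
      · have := (hK v hv).2
        simp only [hv, if_true] at h1
        rw [Finset.card_insert_of_notMem (haC v)]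
        omega
      · simpa [hv] using h1
    · have h1 := hCd u v huv
      dsimp only
      split_ifs with hu hv hv
      · exact (hKadj u hu v hv huv).elim
      · exact Finset.disjoint_insert_left.2 ⟨haC v, h1⟩
      · exact Finset.disjoint_insert_right.2 ⟨haC u, h1⟩
      · exact h1

/-- Even cycles are `(2k : k)`-choosable. -/
theorem choosable_of_iso_cycleGraph [Fintype V] {n : ℕ} (hn : Even (n + 2))
    (e : G ≃g cycleGraph (n + 2)) : G.Choosable (k * 2) k := by
  classical
  intro S hS
  refine exists_coloring_of_function (fun v => e.symm (e v + 1)) (fun v => Even (e v).val) ?_ ?_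
    (Finset.univ.biUnion S) S (fun _ => k) (fun v => Finset.subset_biUnion_of_mem S (by simp)) ?_
  · intro v
    simp only [RelIso.apply_symm_apply, Fin.val_add_one]
    split_ifs with h
    · rw [h, Fin.val_last]
      grind
    · grind
  · intro u v huv
    have h := e.map_adj_iff.2 huv
    rw [cycleGraph_adj] at h
    rcases h with h | h
    · right
      apply e.injective
      simp only [RelIso.apply_symm_apply]
      rw [← h]; abel
    · left
      apply e.injective
      simp only [RelIso.apply_symm_apply]
      rw [← h]; abel
  · intro v _
    rw [hS]
    omega

/-- The first `m + 1` values of `p` are the vertices of a path in `G`. -/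
def IsPathSeq (G : SimpleGraph V) (p : ℕ → V) (m : ℕ) : Prop :=
  (∀ i ≤ m, ∀ j ≤ m, p i = p j → i = j) ∧ ∀ i < m, G.Adj (p i) (p (i + 1))

theorem IsPathSeq.lt_card [Fintype V] {p : ℕ → V} {m : ℕ} (h : G.IsPathSeq p m) :
    m < Fintype.card V := by
  have := Fintype.card_le_of_injective (fun i : Fin (m + 1) => p i) (by
    intro i j hij
    exact Fin.ext (h.1 i (by omega) j (by omega) hij))
  simpa using this

theorem IsPathSeq.extend {p : ℕ → V} {m : ℕ} (h : G.IsPathSeq p m) {v : V}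
    (hv : G.Adj (p m) v) (hnew : ∀ i ≤ m, v ≠ p i) :
    G.IsPathSeq (fun i => if i ≤ m then p i else v) (m + 1) := by
  refine ⟨fun i hi j hj hij => ?_, fun i hi => ?_⟩
  · dsimp only at hij
    split_ifs at hij with h1 h2 h2
    · exact h.1 i h1 j h2 hij
    · exact (hnew i h1 hij.symm).elim
    · exact (hnew j h2 hij).elim
    · omega
  · have him : i ≤ m := by omega
    simp only [him, if_true]
    split_ifs with h1
    · exact h.2 i (by omega)
    · obtain rfl : i = m := by omega
      exact hv

/-- An induced path on three vertices extends to a path whose last vertex has all its neighbors on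
the path. -/
theorem exists_isPathSeq_maximal [Fintype V] {a b c : V} (hab : G.Adj a b) (hbc : G.Adj b c)
    (hac : a ≠ c) : ∃ (m : ℕ) (p : ℕ → V), 2 ≤ m ∧ G.IsPathSeq p m ∧ p 0 = a ∧ p 1 = b ∧ p 2 = c ∧
      ∀ v, G.Adj (p m) v → ∃ i < m, v = p i := by
  classical
  let P : ℕ → Prop := fun m =>
    2 ≤ m ∧ ∃ p : ℕ → V, G.IsPathSeq p m ∧ p 0 = a ∧ p 1 = b ∧ p 2 = c
  have hP2 : P 2 := by
    refine ⟨le_rfl, fun i => if i = 0 then a else if i = 1 then b else c, ⟨?_, ?_⟩, by simp,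
      by simp, by simp⟩
    · intro i hi j hj
      have h1 := hab.ne
      have h2 := hbc.ne
      interval_cases i <;> interval_cases j <;> simp_all [eq_comm]
    · intro i hi
      interval_cases i <;> simpa
  have hlt : ∀ m, P m → m < Fintype.card V := fun m hm => by
    obtain ⟨-, p, hp, -⟩ := hm
    exact hp.lt_card
  have hspec := Nat.findGreatest_spec (P := P) (hlt 2 hP2).le hP2
  set m := Nat.findGreatest P (Fintype.card V) with hm
  obtain ⟨hm2, p, hp, h0, h1, h2⟩ := hspec
  refine ⟨m, p, hm2, hp, h0, h1, h2, fun v hv => ?_⟩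
  by_contra! hcon
  have hnew : ∀ i ≤ m, v ≠ p i := by
    intro i hi
    rcases hi.lt_or_eq with hi | rfl
    · exact hcon i hi
    · exact hv.ne'
  have hP : P (m + 1) := by
    refine ⟨by omega, _, hp.extend hv hnew, ?_⟩
    simp [h0, h1, h2, hm2, show 1 ≤ m by omega]
  exact Nat.findGreatest_is_greatest (Nat.lt_succ_self m) (hlt _ hP).le hP

theorem IsPathSeq.drop {p : ℕ → V} {m j : ℕ} (h : G.IsPathSeq p m) (hj : j ≤ m) :
    G.IsPathSeq (fun i => p (j + i)) (m - j) := by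
  refine ⟨fun a ha b hb hab => ?_, fun a ha => h.2 (j + a) (by omega)⟩
  have := h.1 (j + a) (by omega) (j + b) (by omega) hab
  omega

/-- A function on the vertices of a path prescribed by their positions. -/
theorem IsPathSeq.exists_rank {p : ℕ → V} {m : ℕ} (h : G.IsPathSeq p m) (ρ : ℕ → ℕ) :
    ∃ r : V → ℕ, ∀ i ≤ m, r (p i) = ρ i := by
  classical
  refine ⟨fun v => if hv : ∃ i ≤ m, p i = v then ρ hv.choose else 0, fun i hi => ?_⟩
  have hv : ∃ i' ≤ m, p i' = p i := ⟨i, hi, rfl⟩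
  have := h.1 _ hv.choose_spec.1 _ hi hv.choose_spec.2
  simp only [hv, dif_pos, this]

/-- If the last vertex of a cycle has no neighbors outside the cycle but some other vertex has,
then lists of size `k * d` suffice. -/
theorem Connected.choosable_of_cycle_of_exists_adj [Fintype V] [DecidableRel G.Adj]
    (hG : G.Connected) (hd : ∀ v, G.degree v ≤ d) {q : ℕ → V} {l : ℕ} (hl : 2 ≤ l)
    (hq : G.IsPathSeq q l) (hclose : G.Adj (q l) (q 0))
    (hlast : ∀ v, G.Adj (q l) v → ∃ i ≤ l, v = q i)
    (hout : ∃ i ≤ l, ∃ u, G.Adj (q i) u ∧ ∀ j ≤ l, u ≠ q j) : G.Choosable (k * d) k := by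
  classical
  obtain ⟨i₀, hi₀, hPi₀⟩ := hout
  let P : ℕ → Prop := fun i => ∃ u, G.Adj (q i) u ∧ ∀ j ≤ l, u ≠ q j
  have hspec : P (Nat.findGreatest P l) := Nat.findGreatest_spec (P := P) hi₀ hPi₀
  have hgreat : ∀ t, Nat.findGreatest P l < t → t ≤ l → ¬ P t :=
    fun t h h' => Nat.findGreatest_is_greatest h h'
  have hle := Nat.findGreatest_le (P := P) l
  generalize Nat.findGreatest P l = i at hspec hgreat hle
  obtain ⟨u, hxu, hu⟩ := hspec
  have hil : i < l := by
    refine lt_of_le_of_ne hle ?_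
    rintro rfl
    obtain ⟨j, hj, rfl⟩ := hlast u hxu
    exact hu j hj rfl
  have hnext : ∀ v, G.Adj (q (i + 1)) v → ∃ j ≤ l, v = q j := by
    intro v hv
    by_contra! hcon
    exact hgreat (i + 1) (Nat.lt_succ_self i) hil ⟨v, hv, hcon⟩
  obtain ⟨r, hr⟩ := hq.exists_rank (fun t => if t ≤ i then i - t else (l - t) + 1 + i)
  have hmem : ∀ j ≤ l, j ≠ i + 1 → q j ∈ ((Finset.range (l + 1)).erase (i + 1)).image q :=
    fun j hj hji => Finset.mem_image_of_mem q (by simp; omega)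
  refine hG.choosable_of_exists_rank hd (((Finset.range (l + 1)).erase (i + 1)).image q)
    (x := q i) (y := q (i + 1)) (u := u) (hmem i hle (by omega)) ?_ ?_ (hu _ hil) (hq.2 i hil) hxu
    ?_ r ?_
  · simp only [Finset.mem_image, Finset.mem_erase, Finset.mem_range, not_exists, not_and]
    intro j hj hji
    exact hj.1 (hq.1 j (by omega) (i + 1) hil hji)
  · simp only [Finset.mem_image, Finset.mem_erase, Finset.mem_range, not_exists, not_and]
    intro j hj hji
    exact hu j (by omega) hji.symm
  · intro v hv
    obtain ⟨j, hj, rfl⟩ := hnext v hv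
    refine hmem j hj ?_
    rintro rfl
    exact G.irrefl hv
  · intro v hv hvx
    obtain ⟨t, ht, rfl⟩ := Finset.mem_image.1 hv
    simp only [Finset.mem_erase, Finset.mem_range] at ht
    have hti : t ≠ i := fun h => hvx (h ▸ rfl)
    by_cases htl : t = l
    · subst htl
      refine ⟨q 0, hmem 0 (by omega) (by omega), hclose, ?_⟩
      rw [hr 0 (by omega), hr t le_rfl]
      simp only [Nat.zero_le, if_true]
      split_ifs <;> omega
    · refine ⟨q (t + 1), hmem (t + 1) (by omega) (by omega), hq.2 t (by omega), ?_⟩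
      rw [hr _ (by omega), hr t (by omega)]
      split_ifs <;> omega

/-- A Hamiltonian path starting with an induced path `a, b, c` such that `b` has degree at least
three gives choosability. -/
theorem Connected.choosable_of_hamiltonian [Fintype V] [DecidableRel G.Adj]
    (hG : G.Connected) (hd : ∀ v, G.degree v ≤ d) {p : ℕ → V} {m : ℕ} (hm : 2 ≤ m)
    (hp : G.IsPathSeq p m) (hham : ∀ v, ∃ i ≤ m, v = p i) (hac : ¬ G.Adj (p 0) (p 2))
    (hdeg : 3 ≤ G.degree (p 1)) : G.Choosable (k * d) k := by
  classical
  obtain ⟨j, hj3, hjm, hj⟩ : ∃ j, 3 ≤ j ∧ j ≤ m ∧ G.Adj (p 1) (p j) := by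
    by_contra! hcon
    have hsub : G.neighborFinset (p 1) ⊆ {p 0, p 2} := by
      intro v hv
      rw [mem_neighborFinset] at hv
      obtain ⟨i, hi, rfl⟩ := hham v
      have h3 : i < 3 := by
        by_contra h
        exact hcon i (by omega) hi hv
      interval_cases i
      · simp
      · exact (G.irrefl hv).elim
      · simp
    have := (Finset.card_le_card hsub).trans Finset.card_le_two
    rw [card_neighborFinset_eq_degree] at this
    omega
  have hne : ∀ i ≤ m, ∀ t ≤ m, i ≠ t → p i ≠ p t := fun i hi t ht hit h =>
    hit (hp.1 i hi t ht h)
  obtain ⟨r, hr⟩ := hp.exists_rank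
    (fun i => if i = 1 then 0 else if i ≤ j then j - i + 1 else i - j + 1)
  refine hG.choosable_of_exists_rank hd {p 0, p 2}ᶜ (x := p 1) (y := p 2) (u := p 0) ?_ (by simp)
    (by simp) (hne 0 (by omega) 2 hm (by omega)) (hp.2 1 (by omega)) (hp.2 0 (by omega)).symm
    ?_ r ?_
  · simp [hne 1 (by omega) 0 (by omega), hne 1 (by omega) 2 (by omega)]
  · intro v hv
    simp only [Finset.mem_compl, Finset.mem_insert, Finset.mem_singleton, not_or]
    exact ⟨fun h => hac (h ▸ hv.symm), hv.ne'⟩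
  · intro v hv hv1
    obtain ⟨i, hi, rfl⟩ := hham v
    simp only [Finset.mem_compl, Finset.mem_insert, Finset.mem_singleton, not_or] at hv
    have hi3 : 3 ≤ i := by
      by_contra h
      have : i < 3 := by omega
      interval_cases i <;> simp_all
    have hmem : ∀ t, 3 ≤ t → t ≤ m → p t ∈ ({p 0, p 2}ᶜ : Finset V) := by
      intro t ht htm
      simp [hne t htm 0 (by omega) (by omega), hne t htm 2 (by omega) (by omega)]
    rcases lt_trichotomy i j with hij | rfl | hij
    · refine ⟨p (i + 1), hmem _ (by omega) (by omega), hp.2 i (by omega), ?_⟩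
      rw [hr _ (by omega), hr _ (by omega)]
      split_ifs <;> omega
    · refine ⟨p 1, ?_, hj.symm, ?_⟩
      · simp [hne 1 (by omega) 0 (by omega), hne 1 (by omega) 2 (by omega)]
      rw [hr _ (by omega), hr _ (by omega)]
      split_ifs <;> omega
    · obtain ⟨t, rfl⟩ : ∃ t, i = t + 1 := ⟨i - 1, by omega⟩
      refine ⟨p t, hmem _ (by omega) (by omega), (hp.2 t (by omega)).symm, ?_⟩
      rw [hr _ (by omega), hr _ (by omega)]
      split_ifs <;> omega

/-- A graph of maximum degree two with a Hamiltonian cycle is isomorphic to a cycle graph. -/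
theorem nonempty_iso_cycleGraph [Fintype V] [DecidableRel G.Adj] (hd : ∀ v, G.degree v ≤ 2)
    {q : ℕ → V} {l : ℕ} (hl : 2 ≤ l) (hq : G.IsPathSeq q l) (hclose : G.Adj (q l) (q 0))
    (hham : ∀ v, ∃ i ≤ l, v = q i) : Nonempty (G ≃g cycleGraph (l - 1 + 2)) := by
  classical
  obtain ⟨n, rfl⟩ : ∃ n, l = n + 1 := ⟨l - 1, by omega⟩
  let σ : Fin (n + 2) → V := fun i => q i
  have hinj : Function.Injective σ := fun i j hij =>
    Fin.ext (hq.1 i (by omega) j (by omega) hij)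
  have hsurj : Function.Surjective σ := fun v => by
    obtain ⟨i, hi, rfl⟩ := hham v
    exact ⟨⟨i, by omega⟩, rfl⟩
  have hsucc : ∀ i : Fin (n + 2), G.Adj (σ i) (σ (i + 1)) := by
    intro i
    simp only [σ, Fin.val_add_one]
    split_ifs with h
    · rw [h]
      exact hclose
    · exact hq.2 i (by have := Fin.val_ne_of_ne h; simp at this; omega)
  have hpred : ∀ i : Fin (n + 2), G.Adj (σ i) (σ (i - 1)) := by
    intro i
    simpa using (hsucc (i - 1)).symm
  have hN : ∀ i, G.neighborFinset (σ i) = {σ (i - 1), σ (i + 1)} := by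
    intro i
    symm
    apply Finset.eq_of_subset_of_card_le
    · simp [Finset.insert_subset_iff, hsucc, hpred]
    · rw [Finset.card_pair]
      · exact hd _
      · intro h
        have h2 := hinj h
        have h3 : (1 : Fin (n + 2)) + 1 = 0 := by
          have : i - 1 + (1 + 1) = i - 1 + 0 := by rw [add_zero, ← add_assoc, sub_add_cancel, h2]
          exact add_left_cancel this
        have h4 := congrArg Fin.val h3
        rw [Fin.val_add, Fin.val_one, Fin.val_zero, Nat.mod_eq_of_lt (by omega)] at h4
        omega
  have hbij : Function.Bijective σ := ⟨hinj, hsurj⟩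
  refine ⟨(RelIso.symm ⟨Equiv.ofBijective σ hbij, ?_⟩ : G ≃g cycleGraph (n + 2))⟩
  intro i j
  rw [Equiv.ofBijective_apply, Equiv.ofBijective_apply, ← mem_neighborFinset, hN, cycleGraph_adj,
    Finset.mem_insert, Finset.mem_singleton, hinj.eq_iff, hinj.eq_iff]
  constructor
  · rintro (rfl | rfl)
    · left; abel
    · right; abel
  · rintro (h | h)
    · left; rw [← h]; abel
    · right; rw [← h]; abel

/-- A set of vertices of a connected graph closed under adjacency is everything. -/
theorem Connected.forall_of_adj_closed (hG : G.Connected) {P : V → Prop} {x : V} (hx : P x)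
    (hP : ∀ u v, P u → G.Adj u v → P v) (v : V) : P v := by
  obtain ⟨w⟩ := hG.preconnected x v
  induction w with
  | nil => exact hx
  | cons h _ ih => exact ih (hP _ _ hx h)

/-- Multiple list coloring version of the theorem of Brooks. -/
theorem Connected.choosable_mul_maxDegree [Fintype V] [DecidableRel G.Adj] (hG : G.Connected)
    (hnotcomplete : ¬ ∀ u v : V, u ≠ v → G.Adj u v)
    (hnotoddcycle : ¬ ∃ n : ℕ, Odd n ∧ Nonempty (G ≃g cycleGraph n)) (k : ℕ) :
    G.Choosable (k * G.maxDegree) k := by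
  classical
  have hd : ∀ v, G.degree v ≤ G.maxDegree := G.degree_le_maxDegree
  by_cases hreg : ∃ x, G.degree x < G.maxDegree
  · obtain ⟨x, hx⟩ := hreg
    exact hG.choosable_of_degree_lt hd hx
  push Not at hreg
  push Not at hnotcomplete
  obtain ⟨s, t, hst, hadj⟩ := hnotcomplete
  obtain ⟨w, hw⟩ := hG.exists_walk_length_eq_dist s t
  obtain ⟨a, b, c, hab, hbc, hac, hne⟩ :=
    Walk.exists_adj_adj_not_adj_ne hw (by
      have h1 := (hG.preconnected s t).pos_dist_of_ne hst
      have h2 : G.dist s t ≠ 1 := fun h => hadj (dist_eq_one_iff_adj.1 h)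
      omega)
  obtain ⟨m, p, hm, hp, rfl, rfl, rfl, hlast⟩ := exists_isPathSeq_maximal hab hbc hne
  have hd2 : 2 ≤ G.maxDegree := by
    refine le_trans ?_ (hd (p 1))
    rw [← card_neighborFinset_eq_degree, ← Finset.card_pair hne]
    refine Finset.card_le_card ?_
    simp [Finset.insert_subset_iff, hab.symm, hbc]
  have hex : ∃ j < m, G.Adj (p m) (p j) :=
    ⟨m - 1, by omega, by simpa [show m - 1 + 1 = m by omega] using (hp.2 (m - 1) (by omega)).symm⟩
  have hj := Nat.find_spec hex
  have hjmin := @Nat.find_min _ _ hex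
  generalize Nat.find hex = j at hj hjmin
  have hjm : j + 2 ≤ m := by
    by_contra hcon
    have hsub : G.neighborFinset (p m) ⊆ {p j} := by
      intro v hv
      rw [mem_neighborFinset] at hv
      obtain ⟨i, hi, rfl⟩ := hlast v hv
      have : ¬ i < j := fun h => hjmin h ⟨hi, hv⟩
      obtain rfl : i = j := by omega
      simp
    have h1 := Finset.card_le_card hsub
    rw [card_neighborFinset_eq_degree, Finset.card_singleton] at h1
    have := hreg (p m)
    omega
  have hq := hp.drop hj.1.le
  have hqclose : G.Adj (p (j + (m - j))) (p (j + 0)) := by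
    simpa [show j + (m - j) = m by omega] using hj.2
  by_cases hout : ∃ i ≤ m - j, ∃ u, G.Adj (p (j + i)) u ∧ ∀ i' ≤ m - j, u ≠ p (j + i')
  · refine hG.choosable_of_cycle_of_exists_adj hd (by omega) hq hqclose ?_ hout
    intro v hv
    rw [show j + (m - j) = m by omega] at hv
    obtain ⟨i, hi, rfl⟩ := hlast v hv
    have : ¬ i < j := fun h => hjmin h ⟨hi, hv⟩
    exact ⟨i - j, by omega, by rw [show j + (i - j) = i by omega]⟩
  push Not at hout
  have hcover : ∀ v, ∃ i ≤ m - j, v = p (j + i) :=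
    hG.forall_of_adj_closed (x := p (j + 0)) ⟨0, by omega, rfl⟩ (by
      rintro u v ⟨i, hi, rfl⟩ huv
      exact hout i hi v huv)
  rcases hd2.lt_or_eq with hd3 | hd2
  · refine hG.choosable_of_hamiltonian hd hm hp (fun v => ?_) hac (hd3.trans_le (hreg _))
    obtain ⟨i, hi, rfl⟩ := hcover v
    exact ⟨j + i, by omega, rfl⟩
  · obtain ⟨e⟩ := nonempty_iso_cycleGraph (fun v => hd2 ▸ hd v) (by omega) hq hqclose hcover
    have heven : Even (m - j - 1 + 2) := by
      by_contra h
      exact hnotoddcycle ⟨_, Nat.not_even_iff_odd.1 h, ⟨e⟩⟩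
    rw [← hd2]
    exact choosable_of_iso_cycleGraph heven e

end SimpleGraph

theorem kth_choice_number_le_maxDegree {V : Type*} [Fintype V] (G : SimpleGraph V)
    [DecidableRel G.Adj]
    (hconn : G.Connected)
    (hnotcomplete : ¬ ∀ u v : V, u ≠ v → G.Adj u v)
    (hnotoddcycle : ¬ ∃ n : ℕ, Odd n ∧ Nonempty (G ≃g SimpleGraph.cycleGraph n))
    (k : ℕ) (hk : 0 < k) :
    G.chooseNum k ≤ k * G.maxDegree :=
  Nat.sInf_le (hconn.choosable_mul_maxDegree hnotcomplete hnotoddcycle k)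
end

section
/- Every finite bipartite planar simple graph G is (3k:k)-choosable for every positive integer k. -/
/-- A graph is planar if it admits a drawing in the plane: vertices are mapped to distinct
points, each edge is drawn as a simple arc joining the images of its endpoints, arcs of
distinct edges have disjoint interiors, and no arc passes through the image of a vertex
in its interior. -/
def SimpleGraph.IsPlanar {V : Type*} (G : SimpleGraph V) : Prop :=
  ∃ (f : V → ℝ × ℝ) (γ : V → V → ℝ → ℝ × ℝ),
    Function.Injective f ∧
    (∀ u v, G.Adj u v → ContinuousOn (γ u v) (Set.Icc 0 1)) ∧
    (∀ u v, G.Adj u v → Set.InjOn (γ u v) (Set.Icc 0 1)) ∧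
    (∀ u v, G.Adj u v → γ u v 0 = f u ∧ γ u v 1 = f v) ∧
    (∀ u v, G.Adj u v → ∀ t, γ v u t = γ u v (1 - t)) ∧
    (∀ u v, G.Adj u v → ∀ t ∈ Set.Ioo (0:ℝ) 1, γ u v t ∉ Set.range f) ∧
    (∀ u v u' v', G.Adj u v → G.Adj u' v' → s(u, v) ≠ s(u', v') →
      ∀ t ∈ Set.Ioo (0:ℝ) 1, ∀ t' ∈ Set.Ioo (0:ℝ) 1, γ u v t ≠ γ u' v' t')

section

open Set Topology unitInterval

/-- `u` has a continuous logarithm on `X`. -/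
def HasLog (X : Set ℂ) (u : ℂ → ℂ) : Prop :=
  ∃ g : ℂ → ℂ, ContinuousOn g X ∧ ∀ z ∈ X, Complex.exp (g z) = u z

/-- `X` is a simple arc from `p` to `q`. -/
def IsArc (p q : ℂ) (X : Set ℂ) : Prop :=
  ∃ γ : Path p q, Function.Injective γ ∧ range γ = X

theorem exists_log_of_homotopy {A : Type*} [TopologicalSpace A] (H : I × A → ℂ)
    (hH : Continuous H) (hne : ∀ x, H x ≠ 0) (f₀ : A → ℂ) (hf₀ : Continuous f₀)
    (h₀ : ∀ a, Complex.exp (f₀ a) = H (0, a)) :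
    ∃ f : A → ℂ, Continuous f ∧ ∀ a, Complex.exp (f a) = H (1, a) := by
  let H' : C(I × A, {z : ℂ // z ≠ 0}) := ⟨fun x => ⟨H x, hne x⟩, by fun_prop⟩
  have hl := Complex.isCoveringMap_exp.liftHomotopy_lifts H' ⟨f₀, hf₀⟩
    (fun a => Subtype.ext (h₀ a).symm)
  refine ⟨fun a => Complex.isCoveringMap_exp.liftHomotopy H' ⟨f₀, hf₀⟩
    (fun a => Subtype.ext (h₀ a).symm) (1, a), by fun_prop, fun a => ?_⟩
  exact congrArg Subtype.val (congrFun hl (1, a))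

theorem hasLog_iff_exists_continuous {X : Set ℂ} {u : ℂ → ℂ} :
    HasLog X u ↔ ∃ g : X → ℂ, Continuous g ∧ ∀ z : X, Complex.exp (g z) = u z := by
  classical
  constructor
  · rintro ⟨g, hg, hgu⟩
    exact ⟨fun z => g z, continuousOn_iff_continuous_domRestrict.1 hg, fun z => hgu z z.2⟩
  · rintro ⟨g, hg, hgu⟩
    refine ⟨fun z => if h : z ∈ X then g ⟨z, h⟩ else 0, ?_, fun z hz => ?_⟩
    · rw [continuousOn_iff_continuous_domRestrict]
      convert hg using 1
      ext z
      simp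
    · simpa [hz] using hgu ⟨z, hz⟩

/-- Moving the base point along a path that avoids `X` does not change the class of `z - a`. -/
theorem hasLog_of_joinedIn {X : Set ℂ} {a b : ℂ} (h : JoinedIn Xᶜ a b) :
    HasLog X fun z => (z - b) / (z - a) := by
  obtain ⟨τ, hτ⟩ := h
  rw [hasLog_iff_exists_continuous]
  have hne : ∀ (t : I) (z : X), (z : ℂ) - τ t ≠ 0 := fun t z h0 =>
    hτ t (by rw [← sub_eq_zero.1 h0]; exact z.2)
  have hne0 : ∀ z : X, (z : ℂ) - a ≠ 0 := fun z => by simpa using hne 0 z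
  obtain ⟨f, hf, hfe⟩ := exists_log_of_homotopy
    (fun x : I × X => ((x.2 : ℂ) - τ x.1) / ((x.2 : ℂ) - a))
    (by
      refine Continuous.div (by fun_prop) (by fun_prop) fun x => hne0 x.2)
    (fun x => div_ne_zero (hne _ _) (hne0 _)) (fun _ => 0) continuous_const
    (fun z => by simp [hne0 z])
  exact ⟨f, hf, fun z => by simpa using hfe z⟩

theorem IsArc.hasLog {p q : ℂ} {X : Set ℂ} (h : IsArc p q X) {u : ℂ → ℂ}
    (hu : ContinuousOn u X) (hne : ∀ z ∈ X, u z ≠ 0) : HasLog X u := by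
  obtain ⟨γ, hinj, rfl⟩ := h
  rw [hasLog_iff_exists_continuous]
  have hc : Continuous fun t => u (γ t) :=
    hu.comp_continuous γ.continuous fun t => mem_range_self t
  obtain ⟨f, hf, hfe⟩ := exists_log_of_homotopy (fun x : I × I => u (γ (x.1 * x.2)))
    (hc.comp (continuous_fst.mul continuous_snd)) (fun x => hne _ (mem_range_self _))
    (fun _ => Complex.log (u (γ 0))) continuous_const
    (fun s => by simpa using Complex.exp_log (hne _ ⟨0, γ.source⟩))
  let e := (γ.continuous.isClosedEmbedding hinj).isEmbedding.toHomeomorph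
  refine ⟨fun z => f (e.symm z), hf.comp e.symm.continuous, fun z => ?_⟩
  have : γ (e.symm z) = z := congrArg Subtype.val (e.apply_symm_apply z)
  rw [hfe, one_mul, this]

theorem exists_log_of_ne_zero {h : ℂ → ℂ} (hc : Continuous h) (hne : ∀ z, h z ≠ 0) :
    ∃ g : ℂ → ℂ, Continuous g ∧ ∀ z, Complex.exp (g z) = h z := by
  obtain ⟨f, hf, hfe⟩ := exists_log_of_homotopy (fun x : I × ℂ => h ((x.1 : ℝ) * x.2))
    (by fun_prop) (fun x => hne _) (fun _ => Complex.log (h 0)) continuous_const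
    (fun s => by simpa using Complex.exp_log (hne 0))
  exact ⟨f, hf, fun z => by simpa using hfe z⟩

theorem sub_eq_sub_of_exp_eq {A : Type*} [TopologicalSpace A] {S : Set A} {g₁ g₂ : A → ℂ}
    (hS : IsPreconnected S) (h₁ : ContinuousOn g₁ S) (h₂ : ContinuousOn g₂ S)
    (h : ∀ z ∈ S, Complex.exp (g₁ z) = Complex.exp (g₂ z)) {x y : A} (hx : x ∈ S) (hy : y ∈ S) :
    g₁ x - g₂ x = g₁ y - g₂ y := by
  have h1 : Complex.exp (g₁ x - g₂ x) = 1 := by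
    rw [Complex.exp_sub, h x hx, div_self (Complex.exp_ne_zero _)]
  have key := Complex.isCoveringMap_exp.eqOn_of_comp_eqOn hS h₁
    (h₂.add (continuousOn_const (c := g₁ x - g₂ x)))
    (fun z hz => Subtype.ext (by simp [Complex.exp_add, h z hz, h1])) hx (by simp) hy
  replace key : g₁ y = g₂ y + (g₁ x - g₂ x) := key
  rw [key]; ring

theorem zpow_eq_zero_of_extension {h : ℂ → ℂ} (hc : Continuous h) (hne : ∀ z, h z ≠ 0)
    {U : Set ℂ} (hU : Bornology.IsBounded U) (a : ℂ) (n : ℤ)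
    (hh : ∀ z, z ∉ U → h z = (z - a) ^ n) : n = 0 := by
  obtain ⟨g, hg, hge⟩ := exists_log_of_ne_zero hc hne
  obtain ⟨R, hR, hUR⟩ := hU.subset_ball_lt 0 a
  have hexp : ∀ θ : ℝ, (R : ℂ) * Complex.exp (θ * Complex.I) =
      Complex.exp (Real.log R + θ * Complex.I) := fun θ => by
    rw [Complex.exp_add, ← Complex.ofReal_exp, Real.exp_log hR]
  have key := sub_eq_sub_of_exp_eq (S := (univ : Set ℝ))
    (g₁ := fun θ => g (a + R * Complex.exp (θ * Complex.I)))
    (g₂ := fun θ => n * (Real.log R + θ * Complex.I)) isPreconnected_univ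
    (Continuous.continuousOn (by fun_prop)) (Continuous.continuousOn (by fun_prop))
    (fun θ _ => by
      rw [hge, hh, add_sub_cancel_left, hexp, Complex.exp_int_mul]
      intro hmem
      have := hUR hmem
      rw [Metric.mem_ball, dist_eq_norm, add_sub_cancel_left, norm_mul,
        Complex.norm_exp_ofReal_mul_I] at this
      simp [abs_of_pos hR] at this)
    (mem_univ 0) (mem_univ (2 * Real.pi))
  simp only [Complex.ofReal_mul, Complex.ofReal_ofNat, Complex.exp_two_pi_mul_I,
    Complex.ofReal_zero, zero_mul, Complex.exp_zero] at key
  have h2 : (n : ℂ) * (2 * Real.pi * Complex.I) = 0 := by linear_combination key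
  simpa [Real.pi_ne_zero] using h2

/-- Eilenberg's independence criterion for one bounded complementary domain. -/
theorem eq_zero_of_hasLog {K U : Set ℂ} (hK : IsClosed K) (hUo : IsOpen U)
    (hUb : Bornology.IsBounded U) (hUK : frontier U ⊆ K) {a : ℂ} (ha : a ∈ U) {n : ℤ}
    {v : ℂ → ℂ} (hv : ContinuousOn v (closure U)) (hv0 : ∀ z ∈ closure U, v z ≠ 0)
    (hlog : HasLog K fun z => (z - a) ^ n * v z) : n = 0 := by
  classical
  obtain ⟨g, hg, hge⟩ := hlog
  obtain ⟨G, hG⟩ := ContinuousMap.exists_restrict_eq hK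
    ⟨K.domRestrict g, continuousOn_iff_continuous_domRestrict.1 hg⟩
  have hGg : ∀ z ∈ K, G z = g z := fun z hz => by
    simpa using DFunLike.congr_fun hG ⟨z, hz⟩
  refine zpow_eq_zero_of_extension
    (h := U.piecewise (fun z => Complex.exp (G z) / v z) (fun z => (z - a) ^ n))
    (continuous_piecewise ?_ ?_ ?_) (fun z => ?_) hUb a n fun z hz => by simp [hz]
  · intro z hz
    rw [hGg z (hUK hz), hge z (hUK hz), mul_div_cancel_right₀ _ (hv0 z (frontier_subset_closure hz))]
  · exact ContinuousOn.div (Continuous.continuousOn (by fun_prop)) hv hv0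
  · rw [hUo.isClosed_compl.closure_eq]
    refine ContinuousOn.zpow₀ (by fun_prop) n fun z hz => Or.inl ?_
    rintro h0
    exact hz (by rwa [sub_eq_zero.1 h0])
  · by_cases hz : z ∈ U
    · simp [hz, hv0 z (subset_closure hz)]
    · simp only [hz, not_false_eq_true, piecewise_eq_of_notMem]
      refine zpow_ne_zero _ fun h0 => hz (by rwa [sub_eq_zero.1 h0])

theorem closure_pathComponentIn_inter_compl {K : Set ℂ} (hK : IsClosed K) (a : ℂ) :
    closure (pathComponentIn Kᶜ a) ∩ Kᶜ ⊆ pathComponentIn Kᶜ a := by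
  rintro z ⟨hz, hzK⟩
  have ho := hK.isOpen_compl.pathComponentIn z
  obtain ⟨w, hw, hwa⟩ := mem_closure_iff.1 hz _ ho (mem_pathComponentIn_self hzK)
  exact JoinedIn.trans hwa (JoinedIn.symm hw)

theorem closure_pathComponentIn_subset {K : Set ℂ} (hK : IsClosed K) (a : ℂ) :
    closure (pathComponentIn Kᶜ a) ⊆ pathComponentIn Kᶜ a ∪ K := fun z hz => by
  by_cases hzK : z ∈ K
  · exact Or.inr hzK
  · exact Or.inl (closure_pathComponentIn_inter_compl hK a ⟨hz, hzK⟩)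

theorem frontier_pathComponentIn_subset {K : Set ℂ} (hK : IsClosed K) (a : ℂ) :
    frontier (pathComponentIn Kᶜ a) ⊆ K := by
  rw [(hK.isOpen_compl.pathComponentIn a).frontier_eq]
  rintro z ⟨hz, hz'⟩
  exact (closure_pathComponentIn_subset hK a hz).resolve_left hz'

theorem joinedIn_of_lt_norm {R : ℝ} (hR : 0 < R) {x y : ℂ} (hx : R < ‖x‖) (hy : R < ‖y‖) :
    JoinedIn {z : ℂ | R < ‖z‖} x y := by
  have hx0 : x ≠ 0 := norm_pos_iff.1 (hR.trans hx)
  have hy0 : y ≠ 0 := norm_pos_iff.1 (hR.trans hy)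
  have hconv : Convex ℝ {w : ℂ | Real.log R < w.re} := convex_halfSpace_re_gt _
  have h := (JoinedIn.of_segment_subset (hconv.segment_subset (x := Complex.log x)
    (y := Complex.log y) (by simpa [Complex.log_re] using Real.log_lt_log hR hx)
    (by simpa [Complex.log_re] using Real.log_lt_log hR hy))).map Complex.continuous_exp
  rw [Complex.exp_log hx0, Complex.exp_log hy0] at h
  refine h.mono ?_
  rintro _ ⟨w, hw, rfl⟩
  simpa [Complex.norm_exp] using (Real.log_lt_iff_lt_exp hR).1 hw

theorem isBounded_or_isBounded {K : Set ℂ} (hK : IsCompact K) {a b : ℂ}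
    (hab : ¬JoinedIn Kᶜ a b) : Bornology.IsBounded (pathComponentIn Kᶜ a) ∨
      Bornology.IsBounded (pathComponentIn Kᶜ b) := by
  by_contra! hcon
  obtain ⟨R, hR, hKR⟩ := hK.isBounded.subset_closedBall_lt 0 0
  have hex : ∀ c, ¬Bornology.IsBounded (pathComponentIn Kᶜ c) →
      ∃ x, JoinedIn Kᶜ c x ∧ R < ‖x‖ := fun c hc => by
    by_contra! h
    exact hc ((Metric.isBounded_closedBall (x := (0 : ℂ)) (r := R)).subset
      fun x hx => by simpa using h x hx)
  obtain ⟨x, hax, hx⟩ := hex a hcon.1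
  obtain ⟨y, hby, hy⟩ := hex b hcon.2
  have hsub : {z : ℂ | R < ‖z‖} ⊆ Kᶜ := fun z hz hzK => by
    have := hKR hzK
    simp only [mem_closedBall_zero_iff] at this
    exact absurd hz (not_lt.2 this)
  exact hab (hax.trans (((joinedIn_of_lt_norm hR hx hy).mono hsub).trans hby.symm))

/-- A bounded face that avoids the other points occurs with exponent zero. -/
theorem exponent_eq_zero {K : Set ℂ} (hK : IsClosed K) {a b c : ℂ}
    (ha : a ∈ Kᶜ) (hb : b ∈ Kᶜ) (hc : c ∈ Kᶜ)
    (hab : ¬JoinedIn Kᶜ a b) (hac : ¬JoinedIn Kᶜ a c)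
    (hbdd : Bornology.IsBounded (pathComponentIn Kᶜ a)) {l m n : ℤ}
    (hlog : HasLog K fun z => (z - a) ^ l * ((z - b) ^ m * (z - c) ^ n)) : l = 0 := by
  have hne : ∀ d, d ∈ Kᶜ → ¬JoinedIn Kᶜ a d → ∀ z ∈ closure (pathComponentIn Kᶜ a),
      z - d ≠ 0 := fun d hd had z hz h0 => by
    rw [sub_eq_zero.1 h0] at hz
    exact had (closure_pathComponentIn_inter_compl hK a ⟨hz, hd⟩)
  refine eq_zero_of_hasLog hK (hK.isOpen_compl.pathComponentIn a) hbdd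
    (frontier_pathComponentIn_subset hK a) (mem_pathComponentIn_self ha)
    (v := fun z => (z - b) ^ m * (z - c) ^ n) ?_ ?_ hlog
  · exact ContinuousOn.mul
      (ContinuousOn.zpow₀ (by fun_prop) _ fun z hz => Or.inl (hne b hb hab z hz))
      (ContinuousOn.zpow₀ (by fun_prop) _ fun z hz => Or.inl (hne c hc hac z hz))
  · exact fun z hz => mul_ne_zero (zpow_ne_zero _ (hne b hb hab z hz))
      (zpow_ne_zero _ (hne c hc hac z hz))

theorem HasLog.congr {X : Set ℂ} {u v : ℂ → ℂ} (h : HasLog X u) (huv : ∀ z ∈ X, u z = v z) :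
    HasLog X v := by
  obtain ⟨g, hg, hge⟩ := h
  exact ⟨g, hg, fun z hz => (hge z hz).trans (huv z hz)⟩

theorem sub_ne_zero_of_mem_compl {K : Set ℂ} {a z : ℂ} (ha : a ∈ Kᶜ) (hz : z ∈ K) : z - a ≠ 0 :=
  fun h => ha (by rwa [← sub_eq_zero.1 h])

theorem joinedIn_of_hasLog {K : Set ℂ} (hK : IsCompact K) {a b : ℂ} (ha : a ∈ Kᶜ) (hb : b ∈ Kᶜ)
    (hlog : HasLog K fun z => (z - b) / (z - a)) : JoinedIn Kᶜ a b := by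
  by_contra hab
  rcases isBounded_or_isBounded hK hab with h | h
  · have := exponent_eq_zero hK.isClosed ha hb hb hab hab h (l := -1) (m := 1) (n := 0)
      (hlog.congr fun z _ => by rw [zpow_neg_one, zpow_one, zpow_zero, mul_one, div_eq_inv_mul])
    omega
  · have hba : ¬JoinedIn Kᶜ b a := fun h => hab h.symm
    have := exponent_eq_zero hK.isClosed hb ha ha hba hba h (l := 1) (m := -1) (n := 0)
      (hlog.congr fun z _ => by rw [zpow_neg_one, zpow_one, zpow_zero, mul_one, div_eq_mul_inv])
    omega

theorem exists_glue {X Y : Set ℂ} (hX : IsClosed X) (hY : IsClosed Y) {u g₁ g₂ : ℂ → ℂ}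
    (h₁ : ContinuousOn g₁ X) (h₂ : ContinuousOn g₂ Y) (he₁ : ∀ z ∈ X, Complex.exp (g₁ z) = u z)
    (he₂ : ∀ z ∈ Y, Complex.exp (g₂ z) = u z) (h : ∀ z ∈ X ∩ Y, g₁ z = g₂ z) :
    HasLog (X ∪ Y) u := by
  classical
  have hY' : ∀ z ∈ Y, X.piecewise g₁ g₂ z = g₂ z := fun z hz => by
    by_cases hzX : z ∈ X
    · simp [hzX, h z ⟨hzX, hz⟩]
    · simp [hzX]
  refine ⟨X.piecewise g₁ g₂, ContinuousOn.union_of_isClosed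
    (h₁.congr fun z hz => by simp [hz]) (h₂.congr hY') hX hY, fun z hz => ?_⟩
  by_cases hzX : z ∈ X
  · simp [hzX, he₁ z hzX]
  · simp [hzX, he₂ z (hz.resolve_left hzX)]

theorem HasLog.union {X Y : Set ℂ} (hX : IsClosed X) (hY : IsClosed Y) {u : ℂ → ℂ}
    (h₁ : HasLog X u) (h₂ : HasLog Y u) (h : (X ∩ Y).Subsingleton) : HasLog (X ∪ Y) u := by
  obtain ⟨g₁, hc₁, he₁⟩ := h₁
  obtain ⟨g₂, hc₂, he₂⟩ := h₂
  rcases (X ∩ Y).eq_empty_or_nonempty with h0 | ⟨p, hp⟩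
  · exact exists_glue hX hY hc₁ hc₂ he₁ he₂ (by simp [h0])
  · refine exists_glue hX hY (g₂ := fun z => g₂ z + (g₁ p - g₂ p)) hc₁
      (hc₂.add continuousOn_const) he₁ (fun z hz => ?_) fun z hz => ?_
    · rw [Complex.exp_add, he₂ z hz, Complex.exp_sub, he₁ p hp.1, he₂ p hp.2, ← he₂ p hp.2,
        div_self (Complex.exp_ne_zero _), mul_one]
    · rw [h hz hp]; ring

theorem IsArc.isCompact {p q : ℂ} {X : Set ℂ} (h : IsArc p q X) : IsCompact X := by
  obtain ⟨γ, -, rfl⟩ := h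
  exact isCompact_range γ.continuous

/-- The obstruction to logarithms when an arc is added is measured by a single integer. -/
theorem exists_logs_of_joinedIn {K B : Set ℂ} {p q a b : ℂ} (hB : IsArc p q B)
    (hpK : p ∈ K) (hqK : q ∈ K) (hpB : p ∈ B) (hqB : q ∈ B) (ha : a ∈ Bᶜ) (hb : b ∈ Bᶜ)
    (hab : JoinedIn Kᶜ a b) : ∃ (g h : ℂ → ℂ) (k : ℤ), ContinuousOn g K ∧ ContinuousOn h B ∧
      (∀ z ∈ K, Complex.exp (g z) = (z - b) / (z - a)) ∧
      (∀ z ∈ B, Complex.exp (h z) = (z - b) / (z - a)) ∧ g p = h p ∧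
      h q = g q + k * (2 * Real.pi * Complex.I) := by
  obtain ⟨g, hg, hge⟩ := hasLog_of_joinedIn hab
  obtain ⟨h, hh, hhe⟩ := hB.hasLog (u := fun z => (z - b) / (z - a))
    (ContinuousOn.div (by fun_prop) (by fun_prop) fun z hz => sub_ne_zero_of_mem_compl ha hz)
    fun z hz => div_ne_zero (sub_ne_zero_of_mem_compl hb hz) (sub_ne_zero_of_mem_compl ha hz)
  have he : ∀ z ∈ B, Complex.exp (h z + (g p - h p)) = (z - b) / (z - a) := fun z hz => by
    rw [Complex.exp_add, hhe z hz, Complex.exp_sub, hge p hpK, ← hhe p hpB,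
        div_self (Complex.exp_ne_zero _), mul_one]
  obtain ⟨k, hk⟩ := Complex.exp_eq_exp_iff_exists_int.1 ((he q hqB).trans (hge q hqK).symm)
  exact ⟨g, fun z => h z + (g p - h p), k, hg, hh.add continuousOn_const, hge, he, by ring, hk⟩

/-- Adding an arc to `K` splits a complementary domain into at most two domains. -/
theorem not_three_faces {K B : Set ℂ} {p q : ℂ} (hK : IsCompact K) (hB : IsArc p q B)
    (hKB : K ∩ B = {p, q}) {a b c : ℂ} (ha : a ∈ (K ∪ B)ᶜ) (hb : b ∈ (K ∪ B)ᶜ)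
    (hc : c ∈ (K ∪ B)ᶜ) (hab : ¬JoinedIn (K ∪ B)ᶜ a b) (hac : ¬JoinedIn (K ∪ B)ᶜ a c)
    (hbc : ¬JoinedIn (K ∪ B)ᶜ b c) (hab' : JoinedIn Kᶜ a b) (hac' : JoinedIn Kᶜ a c) :
    False := by
  have hKBc : IsCompact (K ∪ B) := hK.union hB.isCompact
  have hp : p ∈ K ∩ B := by rw [hKB]; simp
  have hq : q ∈ K ∩ B := by rw [hKB]; simp
  have hBsub : ∀ {x}, x ∈ (K ∪ B)ᶜ → x ∈ Bᶜ := fun hx hxB => hx (Or.inr hxB)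
  obtain ⟨g, h, k, hg, hh, hge, hhe, hpe, hqe⟩ :=
    exists_logs_of_joinedIn hB hp.1 hq.1 hp.2 hq.2 (hBsub ha) (hBsub hb) hab'
  obtain ⟨g', h', k', hg', hh', hge', hhe', hpe', hqe'⟩ :=
    exists_logs_of_joinedIn hB hp.1 hq.1 hp.2 hq.2 (hBsub ha) (hBsub hc) hac'
  have hlog : HasLog (K ∪ B) fun z => ((z - b) / (z - a)) ^ k' * ((z - c) / (z - a)) ^ (-k) := by
    refine exists_glue hK.isClosed hB.isCompact.isClosed
      (g₁ := fun z => k' * g z + (-k : ℤ) * g' z) (g₂ := fun z => k' * h z + (-k : ℤ) * h' z)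
      (by fun_prop) (by fun_prop) (fun z hz => ?_) (fun z hz => ?_) fun z hz => ?_
    · rw [Complex.exp_add, Complex.exp_int_mul, Complex.exp_int_mul, hge z hz, hge' z hz]
    · rw [Complex.exp_add, Complex.exp_int_mul, Complex.exp_int_mul, hhe z hz, hhe' z hz]
    · rw [hKB] at hz
      rcases hz with rfl | rfl
      · rw [hpe, hpe']
      · rw [hqe, hqe']; push_cast; ring
  have hne : ∀ {x z : ℂ}, x ∈ (K ∪ B)ᶜ → z ∈ K ∪ B → z - x ≠ 0 := sub_ne_zero_of_mem_compl
  have hlog' : HasLog (K ∪ B) fun z => (z - a) ^ (k - k') * ((z - b) ^ k' * (z - c) ^ (-k)) :=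
    hlog.congr fun z hz => by
      have := hne ha hz
      rw [div_zpow, div_zpow, zpow_sub₀ this, zpow_neg (z - a)]
      field_simp
  have e1 : Bornology.IsBounded (pathComponentIn (K ∪ B)ᶜ a) → k - k' = 0 := fun hbd =>
    exponent_eq_zero hKBc.isClosed ha hb hc hab hac hbd hlog'
  have e2 : Bornology.IsBounded (pathComponentIn (K ∪ B)ᶜ b) → k' = 0 := fun hbd =>
    exponent_eq_zero hKBc.isClosed hb ha hc (fun h => hab h.symm) hbc hbd
      (m := k - k') (n := -k) (hlog'.congr fun z _ => by ring)
  have e3 : Bornology.IsBounded (pathComponentIn (K ∪ B)ᶜ c) → -k = 0 := fun hbd =>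
    exponent_eq_zero hKBc.isClosed hc ha hb (fun h => hac h.symm) (fun h => hbc h.symm) hbd
      (m := k - k') (n := k') (hlog'.congr fun z _ => by ring)
  have hk : k = 0 := by
    rcases isBounded_or_isBounded hKBc hab with h1 | h1 <;>
    rcases isBounded_or_isBounded hKBc hac with h2 | h2 <;>
    rcases isBounded_or_isBounded hKBc hbc with h3 | h3 <;>
    first
      | have := e1 h1; have := e2 h3; omega
      | have := e3 h3; omega
      | have := e3 h2; omega
      | have := e1 h2; have := e2 h1; omega
  refine hab (joinedIn_of_hasLog hKBc ha hb (exists_glue hK.isClosed hB.isCompact.isClosed hg hh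
    hge hhe fun z hz => ?_))
  rw [hKB] at hz
  rcases hz with rfl | rfl
  · exact hpe
  · simp [hqe, hk]

theorem not_hasLog_compl_pair {p q : ℂ} (hpq : p ≠ q) :
    ¬HasLog ({p, q} : Set ℂ)ᶜ fun z => (z - q) / (z - p) := by
  rintro ⟨g, hg, hge⟩
  obtain ⟨r, hr, hq⟩ : ∃ r > 0, q ∉ Metric.closedBall p r := by
    refine ⟨dist q p / 2, half_pos (dist_pos.2 hpq.symm), fun h => ?_⟩
    have := dist_pos.2 hpq.symm
    rw [Metric.mem_closedBall] at h
    linarith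
  have hne : ∀ z ∈ Metric.closedBall p r, z - q ≠ 0 := fun z hz h =>
    hq (by rwa [← sub_eq_zero.1 h])
  have hsub : Metric.sphere p r ⊆ ({p, q} : Set ℂ)ᶜ := by
    rintro z hz (rfl | rfl)
    · rw [Metric.mem_sphere, dist_self] at hz
      exact hr.ne hz
    · exact hq (Metric.sphere_subset_closedBall hz)
  have := eq_zero_of_hasLog (K := Metric.sphere p r) (n := -1) (v := fun z => z - q)
    Metric.isClosed_sphere Metric.isOpen_ball Metric.isBounded_ball
    (frontier_ball p hr.ne').subset (Metric.mem_ball_self hr) (by fun_prop)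
    (fun z hz => hne z (Metric.closure_ball_subset_closedBall hz))
    ⟨g, hg.mono hsub, fun z hz => by simpa [div_eq_inv_mul] using hge z (hsub hz)⟩
  omega

/-- Adding an arc between two points of `K` that are already joined inside `K` disconnects the
complementary domain containing the arc. -/
theorem exists_separated {K B : Set ℂ} {p q b₀ : ℂ} (hK : IsClosed K) (hBc : IsCompact B)
    (hpq : p ≠ q) (hKj : JoinedIn K p q) (hBj : JoinedIn B p q)
    (hB : ∀ z ∈ B, z = p ∨ z = q ∨ JoinedIn Kᶜ b₀ z) :
    ∃ x ∈ (K ∪ B)ᶜ, ∃ y ∈ (K ∪ B)ᶜ, JoinedIn Kᶜ b₀ x ∧ JoinedIn Kᶜ b₀ y ∧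
      ¬JoinedIn (K ∪ B)ᶜ x y := by
  classical
  by_contra! hcon
  obtain ⟨g₁, hg₁, he₁⟩ := hasLog_of_joinedIn (X := Kᶜ) (by rwa [compl_compl])
  obtain ⟨g₂, hg₂, he₂⟩ := hasLog_of_joinedIn (X := Bᶜ) (by rwa [compl_compl])
  set F := pathComponentIn Kᶜ b₀ with hF
  have hFo : IsOpen F := hK.isOpen_compl.pathComponentIn b₀
  have hFK : F ⊆ Kᶜ := pathComponentIn_subset
  have hmem : ∀ x ∈ F, x ∈ Bᶜ → x ∈ (K ∪ B)ᶜ := fun x hx hxB h => h.elim (hFK hx) hxB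
  have hconst : ∀ x ∈ F, x ∈ Bᶜ → ∀ y ∈ F, y ∈ Bᶜ → g₁ x - g₂ x = g₁ y - g₂ y := by
    intro x hx hxB y hy hyB
    have hj := hcon x (hmem x hx hxB) y (hmem y hy hyB) hx hy
    have hsub : (K ∪ B)ᶜ ⊆ Kᶜ := compl_subset_compl.2 subset_union_left
    have hsub' : (K ∪ B)ᶜ ⊆ Bᶜ := compl_subset_compl.2 subset_union_right
    have hpc : IsPathConnected (pathComponentIn (K ∪ B)ᶜ x) :=
      isPathConnected_pathComponentIn (hmem x hx hxB)
    have hs : pathComponentIn (K ∪ B)ᶜ x ⊆ (K ∪ B)ᶜ := pathComponentIn_subset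
    exact sub_eq_sub_of_exp_eq hpc.isConnected.isPreconnected (hg₁.mono (hs.trans hsub))
      (hg₂.mono (hs.trans hsub')) (fun z hz => by
        rw [he₁ z (hsub (hs hz)), he₂ z (hsub' (hs hz))])
      (mem_pathComponentIn_self (hmem x hx hxB)) hj
  obtain ⟨c, hc1, hc⟩ : ∃ c, Complex.exp c = 1 ∧ ∀ x ∈ F, x ∈ Bᶜ → g₁ x = g₂ x + c := by
    by_cases h : ∃ x ∈ F, x ∈ Bᶜ
    · obtain ⟨x, hx, hxB⟩ := h
      refine ⟨g₁ x - g₂ x, ?_, fun y hy hyB => by rw [hconst x hx hxB y hy hyB]; ring⟩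
      rw [Complex.exp_sub, he₁ x (hFK hx), ← he₂ x hxB, div_self (Complex.exp_ne_zero _)]
    · push Not at h
      exact ⟨0, Complex.exp_zero, fun x hx hxB => absurd hxB (h x hx)⟩
  have hB2 : EqOn (F.piecewise g₁ fun z => g₂ z + c) (fun z => g₂ z + c) Bᶜ := fun z hz => by
    by_cases hzF : z ∈ F
    · simp [hzF, hc z hzF hz]
    · simp [hzF]
  have hcover : ∀ z ∈ ({p, q} : Set ℂ)ᶜ, z ∈ F ∨ z ∈ Bᶜ := fun z hz => by
    by_contra! h
    rcases hB z (by simpa using h.2) with rfl | rfl | h3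
    · simp at hz
    · simp at hz
    · exact h.1 h3
  refine not_hasLog_compl_pair hpq ⟨F.piecewise g₁ fun z => g₂ z + c, fun z hz => ?_,
    fun z hz => ?_⟩
  · refine ContinuousAt.continuousWithinAt ?_
    rcases hcover z hz with h | h
    · exact (((hg₁.mono hFK).congr fun w hw => by simp [hw]).continuousAt (hFo.mem_nhds h))
    · exact ((hg₂.add continuousOn_const).congr hB2).continuousAt
        (hBc.isClosed.isOpen_compl.mem_nhds h)
  · rcases hcover z hz with h | h
    · simp [h, he₁ z (hFK h)]
    · rw [hB2 h, Complex.exp_add, hc1, mul_one, he₂ z h]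

theorem IsArc.exists_interior {p q : ℂ} {B : Set ℂ} (h : IsArc p q B) :
    ∃ b₀, ∀ z ∈ B, z = p ∨ z = q ∨ JoinedIn (B \ {p, q}) b₀ z := by
  obtain ⟨γ, hinj, rfl⟩ := h
  refine ⟨γ.extend (1 / 2), ?_⟩
  rintro _ ⟨t, rfl⟩
  by_cases h0 : t = 0
  · exact Or.inl (by simp [h0])
  by_cases h1 : t = 1
  · exact Or.inr (Or.inl (by simp [h1]))
  refine Or.inr (Or.inr ?_)
  have ht : (t : ℝ) ∈ Ioo (0 : ℝ) 1 := ⟨unitInterval.pos_iff_ne_zero.2 h0,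
    unitInterval.lt_one_iff_ne_one.2 h1⟩
  have hj := (JoinedIn.of_segment_subset ((convex_Ioo (0 : ℝ) 1).segment_subset
    (x := 1 / 2) (by norm_num) ht)).map γ.continuous_extend
  rw [γ.extend_apply t.2] at hj
  refine hj.mono ?_
  rintro _ ⟨s, hs, rfl⟩
  have hs' : s ∈ I := ⟨hs.1.le, hs.2.le⟩
  rw [γ.extend_apply hs']
  refine ⟨mem_range_self _, ?_⟩
  rintro (h | h)
  · have := congrArg Subtype.val (hinj (h.trans γ.source.symm))
    exact hs.1.ne' this
  · have := congrArg Subtype.val (hinj (h.trans γ.target.symm))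
    exact hs.2.ne this

/-- A drawing of a graph in the complex plane by simple arcs. -/
structure PlaneDrawing {V : Type*} (G : SimpleGraph V) where
  pt : V → ℂ
  pt_injective : Function.Injective pt
  arc : Sym2 V → Set ℂ
  isArc : ∀ u v, G.Adj u v → IsArc (pt u) (pt v) (arc s(u, v))
  mem_of_pt_mem : ∀ e ∈ G.edgeSet, ∀ w, pt w ∈ arc e → w ∈ e
  inter : ∀ e ∈ G.edgeSet, ∀ e' ∈ G.edgeSet, e ≠ e' → ∀ z ∈ arc e, z ∈ arc e' → z ∈ range pt

theorem SimpleGraph.IsPlanar.nonempty_planeDrawing {V : Type*} {G : SimpleGraph V}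
    (h : G.IsPlanar) : Nonempty (PlaneDrawing G) := by
  obtain ⟨f, γ, hf, hc, hi, he, hs, hv, hd⟩ := h
  let φ := Complex.equivRealProdCLM.symm
  have hsymm : ∀ u v, G.Adj u v → γ u v '' I = γ v u '' I := by
    have : ∀ u v, G.Adj u v → γ u v '' I ⊆ γ v u '' I := by
      rintro u v huv _ ⟨t, ht, rfl⟩
      exact ⟨1 - t, ⟨by linarith [ht.2], by linarith [ht.1]⟩, by rw [hs u v huv]; simp⟩
    exact fun u v huv => (this u v huv).antisymm (this v u huv.symm)
  let arc : Sym2 V → Set ℂ := fun e => {z | ∃ u v, G.Adj u v ∧ e = s(u, v) ∧ z ∈ φ '' (γ u v '' I)}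
  have harc : ∀ u v, G.Adj u v → arc s(u, v) = φ '' (γ u v '' I) := by
    intro u v huv
    ext z
    constructor
    · rintro ⟨u', v', huv', he', hz⟩
      rcases Sym2.eq_iff.1 he' with ⟨rfl, rfl⟩ | ⟨rfl, rfl⟩
      · exact hz
      · rwa [hsymm _ _ huv]
    · exact fun hz => ⟨u, v, huv, rfl, hz⟩
  have hcases : ∀ t ∈ I, t = 0 ∨ t = 1 ∨ t ∈ Ioo (0 : ℝ) 1 := fun t ht => by
    rcases ht.1.eq_or_lt with h | h
    · exact Or.inl h.symm
    rcases ht.2.eq_or_lt with h' | h'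
    · exact Or.inr (Or.inl h')
    · exact Or.inr (Or.inr ⟨h, h'⟩)
  have hpt : ∀ u v, G.Adj u v → ∀ t ∈ I, (t ∈ Ioo (0 : ℝ) 1 ∨ γ u v t ∈ range f) := by
    intro u v huv t ht
    rcases hcases t ht with rfl | rfl | h
    · exact Or.inr ⟨u, (he u v huv).1.symm⟩
    · exact Or.inr ⟨v, (he u v huv).2.symm⟩
    · exact Or.inl h
  refine ⟨⟨fun v => φ (f v), φ.injective.comp hf, arc, fun u v huv => ?_, fun e hE w hw => ?_,
    fun e hE e' hE' hne z hz hz' => ?_⟩⟩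
  · refine ⟨⟨⟨fun t => φ (γ u v t), φ.continuous.comp
      (continuousOn_iff_continuous_domRestrict.1 (hc u v huv))⟩, ?_, ?_⟩, ?_, ?_⟩
    · simp [(he u v huv).1]
    · simp [(he u v huv).2]
    · intro s t hst
      exact Subtype.ext (hi u v huv s.2 t.2 (φ.injective hst))
    · rw [harc u v huv]
      ext z
      simp
  · induction e with | _ u v => ?_
    rw [harc u v hE] at hw
    obtain ⟨_, ⟨t, ht, rfl⟩, hw⟩ := hw
    have hw := φ.injective hw
    rcases hcases t ht with rfl | rfl | h
    · rw [(he u v hE).1] at hw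
      simp [hf hw]
    · rw [(he u v hE).2] at hw
      simp [hf hw]
    · exact absurd ⟨w, hw.symm⟩ (hv u v hE t h)
  · induction e with | _ u v => ?_
    induction e' with | _ u' v' => ?_
    rw [harc u v hE] at hz
    rw [harc u' v' hE'] at hz'
    obtain ⟨_, ⟨t, ht, rfl⟩, rfl⟩ := hz
    obtain ⟨_, ⟨t', ht', rfl⟩, h⟩ := hz'
    have h := φ.injective h
    rcases hpt u v hE t ht with h1 | ⟨w, hw⟩
    · rcases hpt u' v' hE' t' ht' with h2 | ⟨w, hw⟩
      · exact absurd h.symm (hd u v u' v' hE hE' hne t h1 t' h2)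
      · exact ⟨w, by rw [← h, ← hw]⟩
    · exact ⟨w, by rw [← hw]⟩

theorem IsArc.joinedIn {p q : ℂ} {B : Set ℂ} (h : IsArc p q B) : JoinedIn B p q := by
  obtain ⟨γ, -, rfl⟩ := h
  exact ⟨γ, mem_range_self⟩

namespace PlaneDrawing

variable {V : Type*} {G : SimpleGraph V} (d : PlaneDrawing G)

/-- The vertices of a drawing together with the arcs of the edges in `D`. -/
def support (D : Set (Sym2 V)) : Set ℂ := range d.pt ∪ ⋃ e ∈ D, d.arc e

theorem mem_support {D : Set (Sym2 V)} {z : ℂ} :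
    z ∈ d.support D ↔ z ∈ range d.pt ∨ ∃ e ∈ D, z ∈ d.arc e := by
  simp [support]

theorem support_insert (e : Sym2 V) (D : Set (Sym2 V)) :
    d.support (insert e D) = d.support D ∪ d.arc e := by
  rw [support, support, biUnion_insert, union_assoc, union_comm (d.arc e)]

theorem support_mono {D D' : Set (Sym2 V)} (h : D ⊆ D') : d.support D ⊆ d.support D' :=
  union_subset_union_right _ (biUnion_subset_biUnion_left h)

theorem isCompact_arc {e : Sym2 V} (he : e ∈ G.edgeSet) : IsCompact (d.arc e) := by
  induction e with | _ u v => exact (d.isArc u v he).isCompact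

theorem isCompact_support [Finite V] {D : Set (Sym2 V)} (hD : D ⊆ G.edgeSet) :
    IsCompact (d.support D) :=
  (finite_range d.pt).isCompact.union
    ((toFinite D).isCompact_biUnion fun _ he => d.isCompact_arc (hD he))

theorem joinedIn_of_reachable {H : SimpleGraph V} (hH : H ≤ G) {D : Set (Sym2 V)}
    (hD : H.edgeSet ⊆ D) {u v : V} (h : H.Reachable u v) :
    JoinedIn (d.support D) (d.pt u) (d.pt v) := by
  obtain ⟨w⟩ := h
  induction w with
  | nil => exact JoinedIn.refl (Or.inl (mem_range_self _))
  | cons hadj _ ih =>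
    exact ((d.isArc _ _ (hH hadj)).joinedIn.mono fun z hz =>
      d.mem_support.2 (Or.inr ⟨_, hD hadj, hz⟩)).trans ih

theorem support_inter_arc {D : Set (Sym2 V)} (hD : D ⊆ G.edgeSet) {u v : V} (huv : G.Adj u v)
    (he : s(u, v) ∉ D) : d.support D ∩ d.arc s(u, v) = {d.pt u, d.pt v} := by
  ext z
  constructor
  · rintro ⟨h1, h2⟩
    obtain ⟨w, rfl⟩ : z ∈ range d.pt := by
      rcases d.mem_support.1 h1 with h | ⟨e', he', hz⟩
      · exact h
      · exact d.inter _ huv _ (hD he') (by rintro rfl; exact he he') z h2 hz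
    rcases Sym2.mem_iff.1 (d.mem_of_pt_mem _ huv w h2) with rfl | rfl <;> simp
  · have hj := (d.isArc u v huv).joinedIn
    rintro (rfl | rfl)
    · exact ⟨Or.inl (mem_range_self _), hj.source_mem⟩
    · exact ⟨Or.inl (mem_range_self _), hj.target_mem⟩

theorem exists_separated_points [Finite V] {T : SimpleGraph V} (hT : T ≤ G)
    (hr : ∀ u v, G.Adj u v → T.Reachable u v) (D : Finset (Sym2 V))
    (hD : ↑D ⊆ G.edgeSet \ T.edgeSet) :
    ∃ P : Finset ℂ, D.card + 1 ≤ P.card ∧ (∀ a ∈ P, a ∈ (d.support (↑D ∪ T.edgeSet))ᶜ) ∧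
      ∀ a ∈ P, ∀ b ∈ P, JoinedIn (d.support (↑D ∪ T.edgeSet))ᶜ a b → a = b := by
  classical
  induction D using Finset.induction_on with
  | empty =>
    obtain ⟨a, ha⟩ : ((d.support ((↑(∅ : Finset (Sym2 V))) ∪ T.edgeSet))ᶜ).Nonempty := by
      rw [nonempty_compl]
      intro h
      have := d.isCompact_support (D := (↑(∅ : Finset (Sym2 V))) ∪ T.edgeSet) (by
        simpa using hT)
      rw [h] at this
      exact noncompact_univ ℂ this
    exact ⟨{a}, by simp, by simpa using ha, by simp⟩
  | insert e D he ih =>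
    rw [Finset.coe_insert, insert_subset_iff] at hD
    obtain ⟨P, hcard, hP, hPj⟩ := ih hD.2
    induction e with | _ u v => ?_
    have huv : G.Adj u v := hD.1.1
    set D' : Set (Sym2 V) := ↑D ∪ T.edgeSet with hD'
    have hD'G : D' ⊆ G.edgeSet := union_subset (hD.2.trans sdiff_subset) (by simpa using hT)
    have he' : s(u, v) ∉ D' := by
      rintro (h | h)
      · exact he h
      · exact hD.1.2 h
    rw [Finset.coe_insert, insert_union, d.support_insert]
    set K := d.support D' with hK
    have hKB := d.support_inter_arc hD'G huv he'
    have hKc : IsCompact K := d.isCompact_support hD'G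
    obtain ⟨b₀, hb₀⟩ := (d.isArc u v huv).exists_interior
    have hb : ∀ z ∈ d.arc s(u, v), z = d.pt u ∨ z = d.pt v ∨ JoinedIn Kᶜ b₀ z := fun z hz => by
      refine (hb₀ z hz).imp_right (Or.imp_right fun h => h.mono ?_)
      rw [← hKB]
      exact fun y hy hyK => hy.2 ⟨hyK, hy.1⟩
    obtain ⟨x, hx, y, hy, hbx, hby, hxy⟩ := exists_separated hKc.isClosed
      (d.isCompact_arc huv) (d.pt_injective.ne huv.ne)
      (d.joinedIn_of_reachable hT subset_union_right (hr u v huv))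
      (d.isArc u v huv).joinedIn hb
    have hsub : (K ∪ d.arc s(u, v))ᶜ ⊆ Kᶜ := compl_subset_compl.2 subset_union_left
    set Q := P.filter fun a => ¬JoinedIn Kᶜ b₀ a with hQ
    have hxQ : ∀ a ∈ Q, ∀ z, JoinedIn Kᶜ b₀ z → ¬JoinedIn (K ∪ d.arc s(u, v))ᶜ z a :=
      fun a ha z hz h => (Finset.mem_filter.1 ha).2 (hz.trans (h.mono hsub))
    have hQmem : ∀ a ∈ Q, a ∈ (K ∪ d.arc s(u, v))ᶜ := by
      intro a ha h
      have haK := hP a (Finset.mem_filter.1 ha).1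
      have hends : ∀ w, a ≠ d.pt w := fun w hw => haK (Or.inl ⟨w, hw.symm⟩)
      rcases h with h | h
      · exact haK h
      · rcases hb a h with h | h | h
        · exact hends _ h
        · exact hends _ h
        · exact (Finset.mem_filter.1 ha).2 h
    have hyQ : y ∉ Q := fun h => hxQ y h y hby (JoinedIn.refl hy)
    have hxQ' : x ∉ insert y Q := by
      rw [Finset.mem_insert]
      rintro (rfl | h)
      · exact hxy (JoinedIn.refl hx)
      · exact hxQ x h x hbx (JoinedIn.refl hx)
    refine ⟨insert x (insert y Q), ?_, ?_, ?_⟩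
    · rw [Finset.card_insert_of_notMem hxQ', Finset.card_insert_of_notMem hyQ,
        Finset.card_insert_of_notMem he]
      have h1 : (P.filter fun a => JoinedIn Kᶜ b₀ a).card ≤ 1 := by
        rw [Finset.card_le_one]
        intro a ha b hb
        rw [Finset.mem_filter] at ha hb
        exact hPj a ha.1 b hb.1 (ha.2.symm.trans hb.2)
      have h2 : _ + Q.card = P.card :=
        Finset.card_filter_add_card_filter_not (s := P) fun a => JoinedIn Kᶜ b₀ a
      omega
    · simp only [Finset.mem_insert]
      rintro a (rfl | rfl | ha)
      exacts [hx, hy, hQmem a ha]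
    · simp only [Finset.mem_insert]
      rintro a (rfl | rfl | ha) b (rfl | rfl | hb) hab
      · rfl
      · exact absurd hab hxy
      · exact absurd hab (hxQ b hb _ hbx)
      · exact absurd hab.symm hxy
      · rfl
      · exact absurd hab (hxQ b hb _ hby)
      · exact absurd hab.symm (hxQ a ha _ hbx)
      · exact absurd hab.symm (hxQ a ha _ hby)
      · exact hPj a (Finset.mem_filter.1 ha).1 b (Finset.mem_filter.1 hb).1 (hab.mono hsub)

end PlaneDrawing

theorem HasLog.union_finite {X S : Set ℂ} (hX : IsClosed X) {u : ℂ → ℂ} (h : HasLog X u)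
    (hS : S.Finite) (hne : ∀ z ∈ S, u z ≠ 0) : HasLog (X ∪ S) u := by
  induction S, hS using Set.Finite.induction_on with
  | empty => simpa using h
  | @insert p S _ hS ih =>
    rw [insert_eq, union_comm {p}, ← union_assoc]
    refine (ih fun z hz => hne z (mem_insert_of_mem _ hz)).union (hX.union hS.isClosed)
      isClosed_singleton ⟨fun _ => Complex.log (u p), continuousOn_const, ?_⟩
      (subsingleton_singleton.anti inter_subset_right)
    rintro z rfl
    exact Complex.exp_log (hne z (mem_insert _ _))

/-- A nonempty set of at most three edges of a bipartite graph has a leaf. -/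
theorem SimpleGraph.Coloring.exists_leaf {V : Type*} {G : SimpleGraph V} (c : G.Coloring (Fin 2))
    {D : Finset (Sym2 V)} (hD : ↑D ⊆ G.edgeSet) (hne : D.Nonempty) (hcard : D.card ≤ 3) :
    ∃ u v, s(u, v) ∈ D ∧ ∀ e ∈ D, u ∈ e → e = s(u, v) := by
  classical
  by_contra! hcon
  have hstep : ∀ u v, s(u, v) ∈ D → ∃ w, w ≠ v ∧ s(u, w) ∈ D := by
    intro u v huv
    obtain ⟨e, he, ⟨w, rfl⟩, hne⟩ := hcon u v huv
    exact ⟨w, fun h => hne (by rw [h]), he⟩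
  have hc : ∀ u v, s(u, v) ∈ D → c u ≠ c v := fun u v huv => c.valid (hD huv)
  obtain ⟨e, he⟩ := hne
  induction e with | _ a b => ?_
  obtain ⟨b₁, hb₁, h₁⟩ := hstep a b he
  obtain ⟨a₁, ha₁, h₂⟩ := hstep b a (Sym2.eq_swap ▸ he)
  obtain ⟨a₂, ha₂, h₃⟩ := hstep b₁ a (Sym2.eq_swap ▸ h₁)
  have hba₂ : b ≠ a₂ := by
    rintro rfl
    have := hc _ _ he
    have := hc _ _ h₁
    have := hc _ _ h₃
    omega
  have hab := hc _ _ he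
  have hab₁ := hc _ _ h₁
  have : ({s(a, b), s(a, b₁), s(b, a₁), s(b₁, a₂)} : Finset (Sym2 V)).card ≤ D.card := by
    refine Finset.card_le_card ?_
    simp [Finset.insert_subset_iff, he, h₁, h₂, h₃]
  rw [Finset.card_insert_of_notMem, Finset.card_insert_of_notMem, Finset.card_insert_of_notMem,
    Finset.card_singleton] at this
  · omega
  all_goals simp only [Finset.mem_insert, Finset.mem_singleton, Sym2.eq_iff]
  all_goals grind

namespace PlaneDrawing

variable {V : Type*} {G : SimpleGraph V} (d : PlaneDrawing G)

theorem hasLog_arcs (c : G.Coloring (Fin 2)) {u : ℂ → ℂ} (D : Finset (Sym2 V))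
    (hD : ↑D ⊆ G.edgeSet) (hcard : D.card ≤ 3) (hu : ContinuousOn u (⋃ e ∈ D, d.arc e))
    (hne : ∀ z ∈ ⋃ e ∈ D, d.arc e, u z ≠ 0) : HasLog (⋃ e ∈ D, d.arc e) u := by
  classical
  induction D using Finset.strongInduction with
  | H D ih =>
    rcases D.eq_empty_or_nonempty with rfl | hDne
    · exact ⟨0, by simp, by simp⟩
    obtain ⟨v, w, hvw, hleaf⟩ := c.exists_leaf hD hDne hcard
    have hadj : G.Adj v w := hD hvw
    set D' := D.erase s(v, w) with hD'
    have hD'G : ↑D' ⊆ G.edgeSet := fun e he => hD (Finset.mem_of_mem_erase he)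
    have hunion : ⋃ e ∈ D, d.arc e = (⋃ e ∈ D', d.arc e) ∪ d.arc s(v, w) := by
      rw [← Finset.insert_erase hvw, Finset.set_biUnion_insert, union_comm]
    rw [hunion] at hu hne ⊢
    refine (ih D' (Finset.erase_ssubset hvw) hD'G ((Finset.card_erase_le).trans hcard)
      (hu.mono subset_union_left) fun z hz => hne z (Or.inl hz)).union
      (D'.finite_toSet.isCompact_biUnion fun e he => d.isCompact_arc (hD'G he)).isClosed
      (d.isCompact_arc hadj).isClosed ((d.isArc v w hadj).hasLog (hu.mono subset_union_right)
      fun z hz => hne z (Or.inr hz)) ?_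
    refine (subsingleton_singleton (a := d.pt w)).anti ?_
    rintro z ⟨hz, hz'⟩
    obtain ⟨e, he, hze⟩ := mem_iUnion₂.1 hz
    have hne' : e ≠ s(v, w) := Finset.ne_of_mem_erase he
    obtain ⟨x, rfl⟩ := d.inter _ (hD'G he) _ hadj hne' z hze hz'
    rcases Sym2.mem_iff.1 (d.mem_of_pt_mem _ hadj x hz') with rfl | rfl
    · exact absurd (hleaf e (Finset.mem_of_mem_erase he) (d.mem_of_pt_mem _ (hD'G he) x hze)) hne'
    · rfl

/-- The edges on the boundary of the face containing `a`. -/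
def boundary (a : ℂ) : Set (Sym2 V) :=
  {e ∈ G.edgeSet | ∃ z ∈ d.arc e, z ∉ range d.pt ∧
    z ∈ closure (pathComponentIn (d.support G.edgeSet)ᶜ a)}

theorem boundary_subset (a : ℂ) : d.boundary a ⊆ G.edgeSet := sep_subset _ _

theorem four_le_ncard_boundary [Finite V] (c : G.Coloring (Fin 2)) {a b : ℂ}
    (ha : a ∈ (d.support G.edgeSet)ᶜ) (hb : b ∈ (d.support G.edgeSet)ᶜ)
    (hab : ¬JoinedIn (d.support G.edgeSet)ᶜ a b) : 4 ≤ (d.boundary a).ncard := by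
  by_contra! hlt
  have hfin : (d.boundary a).Finite := toFinite _
  set X := d.support (d.boundary a) with hX
  have hsub : (d.support G.edgeSet)ᶜ ⊆ Xᶜ :=
    compl_subset_compl.2 (d.support_mono (d.boundary_subset a))
  have hne : ∀ z ∈ X, (z - b) / (z - a) ≠ 0 := fun z hz =>
    div_ne_zero (sub_ne_zero_of_mem_compl (hsub hb) hz) (sub_ne_zero_of_mem_compl (hsub ha) hz)
  have hcont : ContinuousOn (fun z => (z - b) / (z - a)) X :=
    ContinuousOn.div (by fun_prop) (by fun_prop) fun z hz =>
      sub_ne_zero_of_mem_compl (hsub ha) hz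
  have hXc : IsCompact X := d.isCompact_support (d.boundary_subset a)
  have harcs : ⋃ e ∈ hfin.toFinset, d.arc e ⊆ X := by
    simp only [Finite.mem_toFinset]
    exact subset_union_right
  have hlog : HasLog X fun z => (z - b) / (z - a) := by
    have h := (d.hasLog_arcs c (u := fun z => (z - b) / (z - a)) hfin.toFinset
      (by simpa using d.boundary_subset a)
      (by rw [← ncard_eq_toFinset_card _ hfin]; omega) (hcont.mono harcs)
      fun z hz => hne z (harcs hz)).union_finite
      (hfin.toFinset.finite_toSet.isCompact_biUnion fun e he =>
        d.isCompact_arc (d.boundary_subset a (by simpa using he))).isClosed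
      (finite_range d.pt) (fun z hz => hne z (Or.inl hz))
    simpa [hX, support, union_comm] using h
  obtain ⟨γ, hγ⟩ := joinedIn_of_hasLog hXc (hsub ha) (hsub hb) hlog
  have hK : IsClosed (d.support G.edgeSet) := (d.isCompact_support subset_rfl).isClosed
  have hS : range γ ⊆ pathComponentIn (d.support G.edgeSet)ᶜ a := by
    refine (isPreconnected_range γ.continuous).subset_of_closure_inter_subset
      (hK.isOpen_compl.pathComponentIn a)
      ⟨a, ⟨0, γ.source⟩, mem_pathComponentIn_self ha⟩ ?_
    rintro z ⟨hz, t, rfl⟩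
    by_contra hzF
    have hzK := frontier_pathComponentIn_subset hK a
      (show γ t ∈ frontier _ from ⟨hz, fun h => hzF (interior_subset h)⟩)
    refine hγ t (d.mem_support.2 ?_)
    by_cases hpt : γ t ∈ range d.pt
    · exact Or.inl hpt
    · obtain ⟨e, he, hze⟩ := (d.mem_support.1 hzK).resolve_left hpt
      exact Or.inr ⟨e, ⟨he, _, hze, hpt, hz⟩, hze⟩
  exact hab (hS ⟨1, γ.target⟩)

theorem joinedIn_of_mem_boundary [Finite V] {u v : V} (huv : G.Adj u v) {b₀ : ℂ}
    (hb₀ : ∀ z ∈ d.arc s(u, v), z = d.pt u ∨ z = d.pt v ∨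
      JoinedIn (d.arc s(u, v) \ {d.pt u, d.pt v}) b₀ z) {a : ℂ}
    (h : s(u, v) ∈ d.boundary a) :
    JoinedIn (d.support (G.edgeSet \ {s(u, v)}))ᶜ b₀ a := by
  obtain ⟨-, z, hz, hpt, hcl⟩ := h
  have hKB := d.support_inter_arc (D := G.edgeSet \ {s(u, v)}) sdiff_subset huv (by simp)
  have hK : IsClosed (d.support (G.edgeSet \ {s(u, v)})) :=
    (d.isCompact_support sdiff_subset).isClosed
  have hz' : JoinedIn (d.support (G.edgeSet \ {s(u, v)}))ᶜ b₀ z := by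
    refine (((hb₀ z hz).resolve_left fun h => hpt ⟨u, h.symm⟩).resolve_left
      fun h => hpt ⟨v, h.symm⟩).mono ?_
    rw [← hKB]
    exact fun y hy hyK => hy.2 ⟨hyK, hy.1⟩
  obtain ⟨w, hw, hw'⟩ := mem_closure_iff.1 hcl _ (hK.isOpen_compl.pathComponentIn b₀) hz'
  exact JoinedIn.trans hw (JoinedIn.mono (JoinedIn.symm hw')
    (compl_subset_compl.2 (d.support_mono sdiff_subset)))

open Classical in
theorem card_filter_boundary_le [Finite V] {P : Finset ℂ}
    (hP : ∀ a ∈ P, a ∈ (d.support G.edgeSet)ᶜ)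
    (hPj : ∀ a ∈ P, ∀ b ∈ P, JoinedIn (d.support G.edgeSet)ᶜ a b → a = b)
    {e : Sym2 V} (he : e ∈ G.edgeSet) :
    (P.filter fun a => e ∈ d.boundary a).card ≤ 2 := by
  by_contra! hlt
  obtain ⟨a, b, c, ha, hb, hc, hab, hac, hbc⟩ := Finset.two_lt_card_iff.1 hlt
  rw [Finset.mem_filter] at ha hb hc
  induction e with | _ u v => ?_
  obtain ⟨b₀, hb₀⟩ := (d.isArc u v he).exists_interior
  have hU : d.support (G.edgeSet \ {s(u, v)}) ∪ d.arc s(u, v) = d.support G.edgeSet := by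
    rw [← d.support_insert, insert_sdiff_singleton, insert_eq_of_mem he]
  have hj := fun {x} => d.joinedIn_of_mem_boundary (a := x) he hb₀
  refine not_three_faces (d.isCompact_support sdiff_subset) (d.isArc u v he)
    (d.support_inter_arc (D := G.edgeSet \ {s(u, v)}) sdiff_subset he (by simp))
    (a := a) (b := b) (c := c) ?_ ?_ ?_ ?_ ?_ ?_ ((hj ha.2).symm.trans (hj hb.2))
    ((hj ha.2).symm.trans (hj hc.2)) <;> rw [hU]
  exacts [hP a ha.1, hP b hb.1, hP c hc.1, fun h => hab (hPj a ha.1 b hb.1 h),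
    fun h => hac (hPj a ha.1 c hc.1 h), fun h => hbc (hPj b hb.1 c hc.1 h)]

end PlaneDrawing

theorem SimpleGraph.IsAcyclic.ncard_edgeSet_lt {V : Type*} [Finite V] [Nonempty V]
    {T : SimpleGraph V} (hT : T.IsAcyclic) : T.edgeSet.ncard + 1 ≤ Nat.card V := by
  obtain ⟨F, hTF, -, hF⟩ := connected_top.exists_isTree_le_of_le_of_isAcyclic le_top hT
  rw [← (isTree_iff_connected_and_card.1 hF).2, Nat.card_coe_set_eq]
  exact Nat.add_le_add_right (ncard_le_ncard (edgeSet_subset_edgeSet.2 hTF)) 1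

namespace PlaneDrawing

variable {V : Type*} {G : SimpleGraph V}

/-- A plane bipartite graph has at most twice as many edges as vertices. -/
theorem ncard_edgeSet_le (d : PlaneDrawing G) [Finite V] (c : G.Coloring (Fin 2)) :
    G.edgeSet.ncard ≤ 2 * Nat.card V := by
  classical
  rcases isEmpty_or_nonempty V with hV | hV
  · simp [eq_empty_of_isEmpty G.edgeSet]
  obtain ⟨T, hTG, hT, hr⟩ := G.exists_isAcyclic_reachable_eq_le
  have hsub : T.edgeSet ⊆ G.edgeSet := SimpleGraph.edgeSet_subset_edgeSet.2 hTG
  have hTcard := hT.ncard_edgeSet_lt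
  have hfin : (G.edgeSet \ T.edgeSet).Finite := toFinite _
  have hdiff := ncard_sdiff_add_ncard_of_subset hsub
  obtain ⟨P, hcard, hP, hPj⟩ := d.exists_separated_points hTG
    (fun u v huv => hr ▸ huv.reachable) hfin.toFinset (by simp)
  rw [← ncard_eq_toFinset_card _ hfin] at hcard
  rw [Finite.coe_toFinset, sdiff_union_of_subset hsub] at hP hPj
  by_cases h1 : P.card ≤ 1
  · omega
  have hE : (G.edgeSet).Finite := toFinite _
  have := Finset.card_mul_le_card_mul (s := P) (t := hE.toFinset) (m := 4) (n := 2)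
    (fun a e => e ∈ d.boundary a) (fun a ha => ?_) fun e he => ?_
  · rw [← ncard_eq_toFinset_card _ hE] at this
    omega
  · obtain ⟨b, hb, hab⟩ := Finset.exists_mem_ne (not_le.1 h1) a
    refine (d.four_le_ncard_boundary c (hP a ha) (hP b hb)
      fun h => hab (hPj a ha b hb h).symm).trans_eq ?_
    rw [← ncard_coe_finset]
    congr 1
    ext e
    simpa [Finset.bipartiteAbove] using fun h => d.boundary_subset a h
  · exact d.card_filter_boundary_le hP hPj (by simpa using he)

/-- The drawing of a subgraph obtained by restricting a drawing. -/
def comap (d : PlaneDrawing G) {W : Type*} {H : SimpleGraph W} (f : W ↪ V)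
    (hf : ∀ u v, H.Adj u v → G.Adj (f u) (f v)) :
    PlaneDrawing H :=
  have hE : ∀ e ∈ H.edgeSet, e.map f ∈ G.edgeSet := fun e he => by
    induction e with | _ u v => exact hf u v he
  { pt := fun w => d.pt (f w)
    pt_injective := d.pt_injective.comp f.injective
    arc := fun e => d.arc (e.map f)
    isArc := fun u v huv => d.isArc _ _ (hf u v huv)
    mem_of_pt_mem := fun e he w hw => by
      obtain ⟨x, hx, hxw⟩ := Sym2.mem_map.1 (d.mem_of_pt_mem _ (hE e he) _ hw)
      rwa [← f.injective hxw]
    inter := fun e he e' he' hne z hz hz' => by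
      obtain ⟨w, rfl⟩ := d.inter _ (hE e he) _ (hE e' he')
        (fun h => hne (Sym2.map.injective f.injective h)) z hz hz'
      obtain ⟨x, -, rfl⟩ := Sym2.mem_map.1 (d.mem_of_pt_mem _ (hE e he) _ hz)
      exact ⟨x, rfl⟩ }

theorem card_le_two_mul_touched (d : PlaneDrawing G) [Fintype V] [DecidableEq V]
    (c : G.Coloring (Fin 2))
    (A : Finset (Sym2 V)) (hA : ↑A ⊆ G.edgeSet) :
    A.card ≤ 2 * (Finset.univ.filter fun v => ∃ e ∈ A, v ∈ e).card := by
  set W := Finset.univ.filter fun v => ∃ e ∈ A, v ∈ e with hW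
  let f : W ↪ V := Function.Embedding.subtype _
  let H : SimpleGraph W := (SimpleGraph.fromEdgeSet (A : Set (Sym2 V))).comap f
  have hf : ∀ u v, H.Adj u v → G.Adj (f u) (f v) := fun u v huv =>
    hA ((SimpleGraph.fromEdgeSet_adj _).1 huv).1
  have h := (d.comap f hf).ncard_edgeSet_le (c.comp ⟨f, fun {u v} h => hf u v h⟩)
  rw [Nat.card_eq_fintype_card, Fintype.card_coe] at h
  refine le_trans ?_ h
  rw [← ncard_coe_finset]
  refine le_trans (ncard_le_ncard ?_) (ncard_image_le (f := Sym2.map f) (s := H.edgeSet) (toFinite _))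
  intro e he
  induction e with | _ u v => ?_
  have hu : u ∈ W := Finset.mem_filter.2 ⟨Finset.mem_univ _, _, he, Sym2.mem_mk_left _ _⟩
  have hv : v ∈ W := Finset.mem_filter.2 ⟨Finset.mem_univ _, _, he, Sym2.mem_mk_right _ _⟩
  have huv : G.Adj u v := hA he
  exact ⟨s(⟨u, hu⟩, ⟨v, hv⟩), (SimpleGraph.fromEdgeSet_adj _).2 ⟨he, huv.ne⟩, rfl⟩

/-- A plane bipartite graph has an orientation with all outdegrees at most two. -/
theorem exists_orientation (d : PlaneDrawing G) [Fintype V] (c : G.Coloring (Fin 2)) :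
    ∃ out : V → Finset V, (∀ u, (out u).card ≤ 2) ∧ (∀ u, ∀ v ∈ out u, G.Adj u v) ∧
      ∀ u v, G.Adj u v → v ∈ out u ∨ u ∈ out v := by
  classical
  obtain ⟨f, hf, hft⟩ := (Finset.all_card_le_biUnion_card_iff_exists_injective
    (ι := G.edgeSet) (α := V × Fin 2) fun e => Finset.univ.filter fun p => p.1 ∈ (e : Sym2 V)).1 (by
      intro s
      have h := d.card_le_two_mul_touched c (s.map (Function.Embedding.subtype _)) (by
        intro e he
        obtain ⟨e, -, rfl⟩ := Finset.mem_map.1 he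
        exact e.2)
      rw [Finset.card_map] at h
      refine h.trans_eq ?_
      have h2 : 2 = (Finset.univ : Finset (Fin 2)).card := by simp
      refine (congrArg₂ _ h2 rfl).trans ?_
      rw [mul_comm, ← Finset.card_product]
      congr 1
      ext ⟨v, i⟩
      simp)
  simp only [Finset.mem_filter, Finset.mem_univ, true_and] at hft
  refine ⟨fun u => Finset.univ.filter fun v => ∃ h : G.Adj u v, (f ⟨s(u, v), h⟩).1 = u,
    fun u => ?_, fun u v hv => (Finset.mem_filter.1 hv).2.1, fun u v huv => ?_⟩
  · refine (Finset.card_le_card_of_injOn (t := (Finset.univ : Finset (Fin 2)))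
      (fun v => if h : G.Adj u v then (f ⟨s(u, v), h⟩).2 else 0) (by simp) ?_).trans_eq (by simp)
    intro v hv w hw hvw
    obtain ⟨hv, hv'⟩ := (Finset.mem_filter.1 hv).2
    obtain ⟨hw, hw'⟩ := (Finset.mem_filter.1 hw).2
    simp only [hv, hw, dite_true] at hvw
    have := congrArg Subtype.val (hf (Prod.ext (hv'.trans hw'.symm) hvw))
    exact Sym2.congr_right.1 this
  · rcases Sym2.mem_iff.1 (hft ⟨s(u, v), huv⟩) with h | h
    · exact Or.inl (Finset.mem_filter.2 ⟨Finset.mem_univ _, huv, h⟩)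
    · refine Or.inr (Finset.mem_filter.2 ⟨Finset.mem_univ _, huv.symm, ?_⟩)
      convert h using 3
      exact Subtype.ext Sym2.eq_swap

end PlaneDrawing

/-- In an orientation of a bipartite graph, every vertex set has a kernel. -/
theorem SimpleGraph.Coloring.exists_kernel {V : Type*} {G : SimpleGraph V}
    (c : G.Coloring (Fin 2)) {out : V → Finset V} (hadj : ∀ u, ∀ v ∈ out u, G.Adj u v)
    (hout : ∀ u v, G.Adj u v → v ∈ out u ∨ u ∈ out v) (U : Finset V) :
    ∃ J ⊆ U, (∀ u ∈ J, ∀ v ∈ J, ¬G.Adj u v) ∧ ∀ v ∈ U, v ∉ J → ∃ w ∈ out v, w ∈ J := by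
  classical
  induction U using Finset.strongInduction with
  | H U ih =>
    by_cases h : ∃ v ∈ U, ∀ w ∈ out v, w ∉ U
    · obtain ⟨v, hv, hvU⟩ := h
      obtain ⟨J, hJ, hind, hker⟩ := ih ((U.erase v).filter fun u => v ∉ out u)
        ((Finset.filter_subset _ _).trans_ssubset (Finset.erase_ssubset hv))
      have hJ' : ∀ u ∈ J, u ≠ v ∧ u ∈ U ∧ v ∉ out u := fun u hu => by
        simpa [and_assoc] using hJ hu
      have hnadj : ∀ u ∈ J, ¬G.Adj u v := fun u hu huv =>
        (hout u v huv).elim (hJ' u hu).2.2 fun h => hvU u h (hJ' u hu).2.1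
      refine ⟨insert v J, Finset.insert_subset hv fun u hu => (hJ' u hu).2.1, ?_, ?_⟩
      · simp only [Finset.mem_insert]
        rintro u (rfl | hu) w (rfl | hw)
        · exact G.irrefl
        · exact fun h => hnadj w hw h.symm
        · exact hnadj u hu
        · exact hind u hu w hw
      · intro u hu huJ
        rw [Finset.mem_insert, not_or] at huJ
        by_cases hvu : v ∈ out u
        · exact ⟨v, hvu, Finset.mem_insert_self _ _⟩
        · obtain ⟨w, hw, hwJ⟩ := hker u (by simp [huJ.1, hu, hvu]) huJ.2
          exact ⟨w, hw, Finset.mem_insert_of_mem hwJ⟩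
    · push Not at h
      refine ⟨U.filter fun v => c v = 0, Finset.filter_subset _ _, ?_, ?_⟩
      · intro u hu v hv huv
        exact c.valid huv ((Finset.mem_filter.1 hu).2.trans (Finset.mem_filter.1 hv).2.symm)
      · intro v hv hvJ
        obtain ⟨w, hw, hwU⟩ := h v hv
        have h1 := c.valid (hadj v w hw)
        have h2 : c v ≠ 0 := fun h => hvJ (Finset.mem_filter.2 ⟨hv, h⟩)
        exact ⟨w, hw, Finset.mem_filter.2 ⟨hwU, by omega⟩⟩

/-- The kernel method for multicolorings with prescribed demands `b`. -/
theorem SimpleGraph.Coloring.exists_multicoloring {V : Type*} [Fintype V] {G : SimpleGraph V}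
    (c : G.Coloring (Fin 2)) {out : V → Finset V} (hadj : ∀ u, ∀ v ∈ out u, G.Adj u v)
    (hout : ∀ u v, G.Adj u v → v ∈ out u ∨ u ∈ out v) (b : V → ℕ) (S : V → Finset ℕ)
    (hS : ∀ v, 0 < b v → b v + ∑ w ∈ out v, b w ≤ (S v).card) :
    ∃ C : V → Finset ℕ, (∀ v, C v ⊆ S v) ∧ (∀ v, (C v).card = b v) ∧
      ∀ u v, G.Adj u v → Disjoint (C u) (C v) := by
  classical
  induction hn : ∑ v, b v using Nat.strong_induction_on generalizing b S with
  | _ n ih =>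
    by_cases hb : ∀ v, b v = 0
    · exact ⟨fun _ => ∅, by simp, by simp [hb], by simp⟩
    push Not at hb
    obtain ⟨v₀, hv₀⟩ := hb
    obtain ⟨x, hx⟩ : (S v₀).Nonempty := by
      rw [← Finset.card_pos]
      have := hS v₀ (Nat.pos_of_ne_zero hv₀)
      omega
    obtain ⟨J, hJU, hind, hker⟩ := c.exists_kernel hadj hout
      (Finset.univ.filter fun v => x ∈ S v ∧ 0 < b v)
    have hJ : ∀ v ∈ J, x ∈ S v ∧ 0 < b v := fun v hv => by simpa using hJU hv
    set b' : V → ℕ := fun v => if v ∈ J then b v - 1 else b v with hb'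
    have hle : ∀ v, b' v ≤ b v := fun v => by simp only [hb']; split_ifs <;> omega
    have hlt : ∀ v ∈ J, b' v + 1 = b v := fun v hv => by
      have := (hJ v hv).2
      simp only [hb', hv, if_true]
      omega
    obtain ⟨w₀, hw₀⟩ : J.Nonempty := by
      by_contra h
      rw [Finset.not_nonempty_iff_eq_empty] at h
      obtain ⟨w, -, hw⟩ := hker v₀ (by simp [hx, Nat.pos_of_ne_zero hv₀]) (by simp [h])
      simp [h] at hw
    obtain ⟨C, hCS, hCb, hC⟩ := ih (∑ v, b' v) (by
      rw [← hn]
      exact Finset.sum_lt_sum (fun v _ => hle v) ⟨w₀, Finset.mem_univ _, by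
        have := hlt w₀ hw₀
        omega⟩) b' (fun v => (S v).erase x) (by
      intro v hv
      have hbv : 0 < b v := hv.trans_le (hle v)
      have h1 := hS v hbv
      have h2 : ∑ w ∈ out v, b' w ≤ ∑ w ∈ out v, b w := Finset.sum_le_sum fun w _ => hle w
      have h3 := hle v
      by_cases hxv : x ∈ S v
      · rw [Finset.card_erase_of_mem hxv]
        by_cases hvJ : v ∈ J
        · have := hlt v hvJ
          omega
        · obtain ⟨w, hw, hwJ⟩ := hker v (by simp [hxv, hbv]) hvJ
          have h4 : ∑ w ∈ out v, b' w < ∑ w ∈ out v, b w :=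
            Finset.sum_lt_sum (fun w _ => hle w) ⟨w, hw, by
              have := hlt w hwJ
              omega⟩
          omega
      · rw [Finset.erase_eq_of_notMem hxv]
        omega) rfl
    have hxC : ∀ v, x ∉ C v := fun v h => Finset.notMem_erase x _ (hCS v h)
    refine ⟨fun v => if v ∈ J then insert x (C v) else C v, fun v => ?_, fun v => ?_,
      fun u v huv => ?_⟩ <;> dsimp only
    · have := (hCS v).trans (Finset.erase_subset _ _)
      split_ifs with h
      · exact Finset.insert_subset (hJ v h).1 this
      · exact this
    · split_ifs with h
      · rw [Finset.card_insert_of_notMem (hxC v), hCb, hlt v h]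
      · rw [hCb]
        simp [hb', h]
    · have := hC u v huv
      split_ifs with h1 h2 h2
      · exact absurd huv (hind u h1 v h2)
      · exact Finset.disjoint_insert_left.2 ⟨hxC v, this⟩
      · exact Finset.disjoint_insert_right.2 ⟨hxC u, this⟩
      · exact this

end

theorem bipartite_planar_choosable {V : Type*} [Fintype V] (G : SimpleGraph V)
    (hbip : G.Colorable 2) (hplanar : G.IsPlanar) (k : ℕ) (hk : 0 < k) :
    G.Choosable (3 * k) k := by
  obtain ⟨c⟩ := hbip
  obtain ⟨d⟩ := hplanar.nonempty_planeDrawing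
  obtain ⟨out, hcard, hadj, hout⟩ := d.exists_orientation c
  intro S hS
  refine c.exists_multicoloring hadj hout (fun _ => k) S fun v _ => ?_
  rw [hS, Finset.sum_const, smul_eq_mul]
  have := Nat.mul_le_mul_right k (hcard v)
  omega
end
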